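/- arXiv:1607.03315 — 2 statements merged into one kernel-verified Lean document; each statement's English description precedes it below -/
import Mathlib

section
/- There is no algorithm which, given a finite conjunction Φ of functional dependencies and embedded multivalued dependencies over a finite attribute set, decides whether there exists a finite database satisfying Φ that is not almost trivial (i.e., that fails some functional dependency). Equivalently, the set of finite conjunctions of functional dependencies and embedded multivalued dependencies that are satisfied by some finite database which is not almost trivial is not decidable. -/
/-- A database (under the pure universal relation assumption): a finite nonempty
set `attr` of attributes (coded as natural numbers), a domain `val x` of values
for each attribute `x`, and a nonempty relation `rel` of tuples, a tuple being a
function assigning to each attribute `x ∈ attr` a value in `val x`. -/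
structure DB : Type 1 where
  attr : Finset ℕ
  attr_nonempty : attr.Nonempty
  val : ℕ → Type
  rel : Set ((x : {x // x ∈ attr}) → val x.1)
  rel_nonempty : rel.Nonempty

/-- `s[X] = t[X]`: the tuples `s` and `t` agree on all attributes in `X`. -/
def DB.agree (D : DB) (s t : (x : {x // x ∈ D.attr}) → D.val x.1)
    (X : Finset ℕ) : Prop :=
  ∀ x : {x // x ∈ D.attr}, x.1 ∈ X → s x = t x

/-- `D` satisfies the functional dependency `X → Y`. -/
def DB.SatFD (D : DB) (X Y : Finset ℕ) : Prop :=
  ∀ s ∈ D.rel, ∀ t ∈ D.rel, D.agree s t X → D.agree s t Y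

/-- `D` satisfies the embedded multivalued dependency `[X, Y]`. -/
def DB.SatEMVD (D : DB) (X Y : Finset ℕ) : Prop :=
  ∀ t₁ ∈ D.rel, ∀ t₂ ∈ D.rel, D.agree t₁ t₂ (X ∩ Y) →
    ∃ t ∈ D.rel, D.agree t t₁ X ∧ D.agree t t₂ Y


/-- `D` is a finite database: all attribute domains are finite. -/
def DB.IsFinite (D : DB) : Prop := ∀ x : ℕ, Finite (D.val x)

/-- `D` is almost trivial: every attribute is a key, i.e. `D` satisfies every
functional dependency (between nonempty subsets of its attribute set). -/
def DB.AlmostTrivial (D : DB) : Prop :=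
  ∀ X Y : Finset ℕ, X.Nonempty → Y.Nonempty → X ⊆ D.attr → Y ⊆ D.attr →
    D.SatFD X Y

/-- A dependency: a functional dependency `X → Y` or an embedded multivalued
dependency `[X, Y]`. -/
inductive Dep : Type where
  | fd : Finset ℕ → Finset ℕ → Dep
  | emvd : Finset ℕ → Finset ℕ → Dep

/-- Well-formedness of a dependency over the attribute set `U`: both attribute
sets are nonempty subsets of `U`. -/
def Dep.WF (U : Finset ℕ) : Dep → Prop
  | .fd X Y => X.Nonempty ∧ Y.Nonempty ∧ X ⊆ U ∧ Y ⊆ U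
  | .emvd X Y => X.Nonempty ∧ Y.Nonempty ∧ X ⊆ U ∧ Y ⊆ U

/-- Satisfaction of a dependency by a database. -/
def DB.SatDep (D : DB) : Dep → Prop
  | .fd X Y => D.SatFD X Y
  | .emvd X Y => D.SatEMVD X Y

/-- An injective Gödel numbering of dependencies. -/
def Dep.code : Dep → ℕ
  | .fd X Y => 2 * Nat.pair (Encodable.encode X) (Encodable.encode Y)
  | .emvd X Y => 2 * Nat.pair (Encodable.encode X) (Encodable.encode Y) + 1

/-- A (natural) Gödel numbering of pairs (attribute set, conjunction of
dependencies). -/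
def depInputCode (U : Finset ℕ) (Φ : List Dep) : ℕ :=
  Nat.pair (Encodable.encode U) (Encodable.encode (Φ.map Dep.code))

namespace DBConsistency

open Function

/-! ### Latin squares in a relation and the bijections they define -/

/-- The columns `x`, `y`, `p` of a relation with rows `R` form a Latin square. -/
structure Latin {R α β γ : Type*} (x : R → α) (y : R → β) (p : R → γ) : Prop where
  pair_p : ∀ s t, x s = x t → y s = y t → p s = p t
  left_p : ∀ s t, x s = x t → p s = p t → y s = y t
  right_p : ∀ s t, y s = y t → p s = p t → x s = x t
  indep_left : ∀ s t, ∃ r, x r = x s ∧ p r = p t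
  indep_right : ∀ s t, ∃ r, y r = y s ∧ p r = p t

/-- The bijections `β ≃ α` cut out by the values of `p`. -/
def bijections {R α β γ : Type*} (x : R → α) (y : R → β) (p : R → γ) : Set (β ≃ α) :=
  {φ | ∃ t, ∀ r, p r = p t ↔ φ (y r) = x r}

/-- A set of bijections is sharply transitive. -/
def Sharp {α β : Type*} (F : Set (β ≃ α)) : Prop :=
  (∀ b a, ∃ φ ∈ F, φ b = a) ∧ ∀ φ ∈ F, ∀ ψ ∈ F, ∀ b, φ b = ψ b → φ = ψ

section Latin

variable {R α β γ : Type*} {x : R → α} {y : R → β} {p : R → γ}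

theorem Latin.exists_equiv (h : Latin x y p) (hx : Surjective x) (hy : Surjective y) (t : R) :
    ∃ φ : β ≃ α, ∀ r, p r = p t ↔ φ (y r) = x r := by
  have h1 : ∀ b, ∃ r, y r = b ∧ p r = p t := fun b => by
    obtain ⟨s, rfl⟩ := hy b
    exact h.indep_right s t
  choose g hg1 hg2 using h1
  have key : ∀ r, p r = p t → x (g (y r)) = x r := fun r hr =>
    h.right_p _ _ (hg1 _) ((hg2 _).trans hr.symm)
  have hbij : Bijective fun b => x (g b) := by
    constructor
    · intro b b' hb
      have := h.left_p _ _ hb ((hg2 b).trans (hg2 b').symm)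
      rwa [hg1, hg1] at this
    · intro a
      obtain ⟨s, rfl⟩ := hx a
      obtain ⟨r, hr1, hr2⟩ := h.indep_left s t
      exact ⟨y r, (key r hr2).trans hr1⟩
  refine ⟨Equiv.ofBijective _ hbij, fun r => ⟨fun hr => key r hr, fun hr => ?_⟩⟩
  exact (h.pair_p _ _ hr (hg1 _)).symm.trans (hg2 _)

theorem Latin.sharp (h : Latin x y p) (hx : Surjective x) (hy : Surjective y)
    (hind : ∀ a b, ∃ r, x r = a ∧ y r = b) : Sharp (bijections x y p) := by
  refine ⟨fun b a => ?_, ?_⟩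
  · obtain ⟨r, rfl, rfl⟩ := hind a b
    obtain ⟨φ, hφ⟩ := h.exists_equiv hx hy r
    exact ⟨φ, ⟨r, hφ⟩, (hφ r).1 rfl⟩
  · rintro φ ⟨t, ht⟩ ψ ⟨t', ht'⟩ b hb
    obtain ⟨r, hr1, hr2⟩ := hind (φ b) b
    have e : p t = p t' := by
      rw [← (ht r).2 (by rw [hr1, hr2]), ← (ht' r).2 (by rw [hr1, hr2, hb])]
    ext b'
    obtain ⟨r', hr1', hr2'⟩ := hind (φ b') b'
    have := (ht' r').1 (e ▸ (ht r').2 (by rw [hr1', hr2']))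
    rw [hr2', hr1'] at this
    exact this.symm

end Latin

theorem bijections_comp {R α β γ δ₁ δ₂ δ₃ : Type*} [Nonempty R] {x : R → α} {y : R → β} {z : R → γ}
    {p : R → δ₁} {q : R → δ₂} {e : R → δ₃} (he : Latin x z e)
    (hind : ∀ a b c, ∃ r, x r = a ∧ y r = b ∧ z r = c)
    (hfd : ∀ s t, p s = p t → q s = q t → e s = e t) {φ : β ≃ α} {ψ : γ ≃ β}
    (hφ : φ ∈ bijections x y p) (hψ : ψ ∈ bijections y z q) :
    ψ.trans φ ∈ bijections x z e := by
  obtain ⟨t, ht⟩ := hφ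
  obtain ⟨t', ht'⟩ := hψ
  have h1 : ∀ c, ∃ r, z r = c ∧ x r = φ (ψ c) ∧ p r = p t ∧ q r = q t' := fun c => by
    obtain ⟨r, h1, h2, h3⟩ := hind (φ (ψ c)) (ψ c) c
    exact ⟨r, h3, h1, (ht r).2 (by rw [h1, h2]), (ht' r).2 (by rw [h2, h3])⟩
  choose g hz hx hp hq using h1
  inhabit R
  have he0 : ∀ c, e (g c) = e (g (z default)) := fun c =>
    hfd _ _ ((hp _).trans (hp _).symm) ((hq _).trans (hq _).symm)
  refine ⟨g (z default), fun r => ⟨fun hr => ?_, fun hr => ?_⟩⟩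
  · have := he.right_p (g (z r)) r (hz _) ((he0 _).trans hr.symm)
    rw [Equiv.trans_apply, ← this, hx]
  · rw [← he0 (z r)]
    refine he.pair_p _ _ ?_ (hz _).symm
    rw [hx, ← hr, Equiv.trans_apply]

/-- Three independent columns together with, for every symbol `k ≤ m`, a Latin square on each
pair of them: under multiplicativity these give a map from symbols to a group. -/
theorem exists_symbol_representation {R α β γ : Type} [Nonempty R] {x : R → α} {y : R → β}
    {z : R → γ} {π : ℕ → Type} (p : (a : ℕ) → R → π a) (P : ℕ → ℕ → ℕ) (m ε : ℕ) (hε : ε ≤ m)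
    (Mul : ℕ → ℕ → ℕ → Prop) (hx : Surjective x) (hy : Surjective y) (hz : Surjective z)
    (hind : ∀ a b c, ∃ r, x r = a ∧ y r = b ∧ z r = c)
    (h12 : ∀ k ≤ m, Latin x y (p (P 0 k))) (h23 : ∀ k ≤ m, Latin y z (p (P 1 k)))
    (h13 : ∀ k ≤ m, Latin x z (p (P 2 k)))
    (hMul : ∀ u v w, Mul u v w → ∀ s t, p (P 0 u) s = p (P 0 u) t →
      p (P 1 v) s = p (P 1 v) t → p (P 2 w) s = p (P 2 w) t)
    (hl : ∀ k ≤ m, Mul k 0 k) (hr : ∀ k ≤ m, Mul 0 k k)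
    (hfix : ∀ s t, p (P 0 0) s = p (P 0 0) t → p (P 0 ε) s = p (P 0 ε) t → y s = y t) :
    ∃ ρ : ℕ → Equiv.Perm γ, ρ 0 = 1 ∧
      (∀ u v w, u ≤ m → v ≤ m → w ≤ m → Mul u v w → ρ u * ρ v = ρ w) ∧
      (ρ ε = 1 → Subsingleton α ∧ Subsingleton β ∧ Subsingleton γ) := by
  have s12 : ∀ k ≤ m, Sharp (bijections x y (p (P 0 k))) := fun k hk =>
    (h12 k hk).sharp hx hy fun a b => by
      obtain ⟨r, h1, h2, -⟩ := hind a b (z (Classical.arbitrary R)); exact ⟨r, h1, h2⟩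
  have s23 : ∀ k ≤ m, Sharp (bijections y z (p (P 1 k))) := fun k hk =>
    (h23 k hk).sharp hy hz fun a b => by
      obtain ⟨r, -, h1, h2⟩ := hind (x (Classical.arbitrary R)) a b; exact ⟨r, h1, h2⟩
  have s13 : ∀ k ≤ m, Sharp (bijections x z (p (P 2 k))) := fun k hk =>
    (h13 k hk).sharp hx hz fun a b => by
      obtain ⟨r, h1, -, h2⟩ := hind a (y (Classical.arbitrary R)) b; exact ⟨r, h1, h2⟩
  inhabit R
  obtain ⟨A, hA, -⟩ := (s12 0 m.zero_le).1 (y default) (x default)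
  obtain ⟨B, hB, -⟩ := (s23 0 m.zero_le).1 (z default) (y default)
  have comp : ∀ u v w, w ≤ m → Mul u v w → ∀ φ ∈ bijections x y (p (P 0 u)),
      ∀ ψ ∈ bijections y z (p (P 1 v)), ψ.trans φ ∈ bijections x z (p (P 2 w)) :=
    fun u v w hw h φ hφ ψ hψ => bijections_comp (h13 w hw) hind (hMul u v w h) hφ hψ
  let N : ℕ → Set (Equiv.Perm γ) := fun k =>
    {σ | (σ.trans B).trans A ∈ bijections x z (p (P 2 k))}
  have hN12 : ∀ k ≤ m, ∀ σ ∈ N k, ∃ φ ∈ bijections x y (p (P 0 k)),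
      B.trans φ = (σ.trans B).trans A := by
    intro k hk σ hσ
    obtain ⟨φ, hφ, h⟩ := (s12 k hk).1 (B (z default)) (A (B (σ (z default))))
    exact ⟨φ, hφ, (s13 k hk).2 _ (comp k 0 k hk (hl k hk) φ hφ B hB) _ hσ (z default) h⟩
  have hN23 : ∀ k ≤ m, ∀ σ ∈ N k, σ.trans B ∈ bijections y z (p (P 1 k)) := by
    intro k hk σ hσ
    obtain ⟨ψ, hψ, h⟩ := (s23 k hk).1 (z default) (B (σ (z default)))
    have := (s13 k hk).2 _ (comp 0 k k hk (hr k hk) A hA ψ hψ) _ hσ (z default)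
      (by simp [h])
    have e : ψ = σ.trans B := by
      ext c
      exact A.injective (Equiv.congr_fun this c)
    exact e ▸ hψ
  have hmul : ∀ u v w, u ≤ m → v ≤ m → w ≤ m → Mul u v w →
      ∀ σ ∈ N u, ∀ τ ∈ N v, σ * τ ∈ N w := by
    intro u v w hu hv hw h σ hσ τ hτ
    obtain ⟨φ, hφ, e⟩ := hN12 u hu σ hσ
    have := comp u v w hw h φ hφ _ (hN23 v hv τ hτ)
    have e2 : (τ.trans B).trans φ = ((σ * τ).trans B).trans A := by
      ext c
      exact Equiv.congr_fun e (τ c)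
    change _ ∈ bijections _ _ _
    rwa [← e2]
  have hex : ∀ k, ∃ σ : Equiv.Perm γ, k ≤ m → σ ∈ N k ∧ σ (z default) = z default := by
    intro k
    by_cases hk : k ≤ m
    · obtain ⟨θ, hθ, h⟩ := (s13 k hk).1 (z default) (A (B (z default)))
      refine ⟨(θ.trans A.symm).trans B.symm, fun _ => ⟨?_, by simp [h]⟩⟩
      have : ((((θ.trans A.symm).trans B.symm).trans B).trans A) = θ := by ext; simp
      change _ ∈ bijections _ _ _
      rwa [this]
    · exact ⟨1, fun h => absurd h hk⟩
  choose ρ hρ using hex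
  have huniq : ∀ k ≤ m, ∀ σ ∈ N k, σ (z default) = z default → ρ k = σ := by
    intro k hk σ hσ h
    have := (s13 k hk).2 _ (hρ k hk).1 _ hσ (z default) (by simp [h, (hρ k hk).2])
    ext c
    exact B.injective (A.injective (Equiv.congr_fun this c))
  refine ⟨ρ, huniq 0 m.zero_le _ ?_ rfl, ?_, fun h => ?_⟩
  · exact comp 0 0 0 m.zero_le (hl 0 m.zero_le) A hA B hB
  · intro u v w hu hv hw h
    refine (huniq w hw _ (hmul u v w hu hv hw h _ (hρ u hu).1 _ (hρ v hv).1) ?_).symm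
    rw [Equiv.Perm.mul_apply, (hρ v hv).2, (hρ u hu).2]
  · obtain ⟨φ, hφ, e⟩ := hN12 ε hε (ρ ε) (hρ ε hε).1
    have hφA : φ = A := by
      ext b
      have := Equiv.congr_fun e (B.symm b)
      simpa [h] using this
    subst hφA
    obtain ⟨t, ht⟩ := hA
    obtain ⟨t', ht'⟩ := hφ
    have hβ : Subsingleton β := by
      refine ⟨fun b b' => ?_⟩
      obtain ⟨r, h1, h2, -⟩ := hind (φ b) b (z default)
      obtain ⟨r', h1', h2', -⟩ := hind (φ b') b' (z default)
      have a1 : φ (y r) = x r := by rw [h1, h2]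
      have a2 : φ (y r') = x r' := by rw [h1', h2']
      have := hfix r r' (((ht r).2 a1).trans ((ht r').2 a2).symm)
        (((ht' r).2 a1).trans ((ht' r').2 a2).symm)
      rwa [h2, h2'] at this
    exact ⟨φ.symm.subsingleton, hβ, B.subsingleton⟩

/-! ### The dependencies attached to a symbol multiplication table -/

/-- The attribute attached to the symbol `k` and the `j`-th pair of base attributes. -/
def lineAttr (j k : ℕ) : ℕ := 3 * k + j + 3

/-- Independence of the base attributes `0`, `1`, `2`. -/
def baseDeps : List Dep := [.emvd {1} {2}, .emvd {0} {1, 2}]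

/-- The attributes `a`, `b`, `p` form a Latin square. -/
def latinDeps (a b p : ℕ) : List Dep :=
  [.fd {a, b} {p}, .fd {a, p} {b}, .fd {b, p} {a}, .emvd {a} {p}, .emvd {b} {p}]

/-- The symbol `k` is represented on each pair of base attributes. -/
def symbolDeps (k : ℕ) : List Dep :=
  latinDeps 0 1 (lineAttr 0 k) ++ latinDeps 1 2 (lineAttr 1 k) ++ latinDeps 0 2 (lineAttr 2 k)

/-- The symbols satisfy `u * v = w`. -/
def mulDep (u v w : ℕ) : Dep := .fd {lineAttr 0 u, lineAttr 1 v} {lineAttr 2 w}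

/-- The symbol coding the word `a :: l` is the product of the symbols coding `[a]` and `l`. -/
def consDep (k : ℕ) : Dep := mulDep (Nat.pair k.unpair.1 0 + 1) k.unpair.2 (k + 1)

/-- The dependencies saying that the symbols below `m` behave as words subject to the relations
`R`, and that the symbol `ε` acts without nontrivial fixed points. -/
def presDeps (m : ℕ) (R : List (ℕ × ℕ)) (ε : ℕ) : List Dep :=
  baseDeps ++ ((List.range (m + 1)).flatMap fun k => symbolDeps k ++ [mulDep k 0 k, mulDep 0 k k]) ++
    (List.range m).map consDep ++ R.map (fun r => mulDep r.1 0 r.2) ++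
    [.fd {lineAttr 0 0, lineAttr 0 ε} {1}]

/-- The attributes used by `presDeps m`. -/
def presAttr (m : ℕ) : Finset ℕ := Finset.range (3 + 3 * (m + 1))

theorem pair_unpair_zero_le (k : ℕ) : Nat.pair k.unpair.1 0 ≤ k := by
  conv_rhs => rw [← Nat.pair_unpair k]
  rcases Nat.eq_zero_or_pos k.unpair.2 with h | h
  · rw [h]
  · exact (Nat.pair_lt_pair_right _ h).le

theorem presDeps_wf {m : ℕ} {R : List (ℕ × ℕ)} {ε : ℕ} (hε : ε ≤ m)
    (hR : ∀ r ∈ R, r.1 ≤ m ∧ r.2 ≤ m) : ∀ d ∈ presDeps m R ε, d.WF (presAttr m) := by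
  have hm : ∀ u v w, u ≤ m → v ≤ m → w ≤ m → (mulDep u v w).WF (presAttr m) := by
    intro u v w hu hv hw
    simp only [mulDep, Dep.WF, presAttr, lineAttr, Finset.insert_subset_iff,
      Finset.singleton_subset_iff, Finset.mem_range]
    refine ⟨by simp, by simp, ⟨?_, ?_⟩, ?_⟩ <;> omega
  have hl : ∀ a b p, a < 3 → b < 3 → p < 3 + 3 * (m + 1) → ∀ d ∈ latinDeps a b p,
      d.WF (presAttr m) := by
    intro a b p ha hb hp d hd
    simp only [latinDeps, List.mem_cons, List.not_mem_nil, or_false] at hd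
    rcases hd with rfl | rfl | rfl | rfl | rfl <;>
    · simp only [Dep.WF, presAttr, Finset.insert_subset_iff,
        Finset.singleton_subset_iff, Finset.mem_range]
      simp
      omega
  intro d hd
  simp only [presDeps, List.mem_append, List.mem_flatMap, List.mem_map, List.mem_range,
    List.mem_cons, List.not_mem_nil, or_false, symbolDeps, baseDeps] at hd
  rcases hd with ((((rfl | rfl) | ⟨k, hk, ((h | h) | h) | rfl | rfl⟩) | ⟨k, hk, rfl⟩) |
    ⟨r, hr, rfl⟩) | rfl
  · simp [Dep.WF, presAttr]
    omega
  · simp [Dep.WF, presAttr, Finset.insert_subset_iff]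
    omega
  · exact hl _ _ _ (by omega) (by omega) (by unfold lineAttr; omega) _ h
  · exact hl _ _ _ (by omega) (by omega) (by unfold lineAttr; omega) _ h
  · exact hl _ _ _ (by omega) (by omega) (by unfold lineAttr; omega) _ h
  · exact hm _ _ _ (by omega) (by omega) (by omega)
  · exact hm _ _ _ (by omega) (by omega) (by omega)
  · exact hm _ _ _ ((pair_unpair_zero_le k).trans_lt hk) ((Nat.unpair_right_le k).trans hk.le) hk
  · exact hm _ _ _ (hR r hr).1 (by omega) (hR r hr).2
  · simp only [Dep.WF, presAttr, lineAttr, Finset.insert_subset_iff,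
      Finset.singleton_subset_iff, Finset.mem_range]
    simp
    omega

/-! ### From databases to permutation representations -/

/-- The column of the attribute `a`, with a dummy value outside of the attribute set. -/
def column (D : DB) (a : ℕ) (s : D.rel) : Option (D.val a) :=
  if h : a ∈ D.attr then some (s.1 ⟨a, h⟩) else none

theorem agree_iff (D : DB) (s t : D.rel) (X : Finset ℕ) :
    D.agree s.1 t.1 X ↔ ∀ a ∈ X, column D a s = column D a t := by
  constructor
  · intro h a ha
    by_cases haD : a ∈ D.attr
    · simp only [column, haD, dif_pos]
      rw [h ⟨a, haD⟩ ha]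
    · simp [column, haD]
  · intro h a ha
    simpa [column, a.2] using h a.1 ha

theorem satDep_fd_iff (D : DB) (X Y : Finset ℕ) : D.SatDep (.fd X Y) ↔
    ∀ s t : D.rel, (∀ a ∈ X, column D a s = column D a t) →
      ∀ a ∈ Y, column D a s = column D a t := by
  simp only [DB.SatDep, DB.SatFD, ← agree_iff]
  exact ⟨fun h s t => h s.1 s.2 t.1 t.2, fun h s hs t ht => h ⟨s, hs⟩ ⟨t, ht⟩⟩

theorem satDep_emvd_iff (D : DB) (X Y : Finset ℕ) : D.SatDep (.emvd X Y) ↔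
    ∀ s t : D.rel, (∀ a ∈ X ∩ Y, column D a s = column D a t) →
      ∃ r : D.rel, (∀ a ∈ X, column D a r = column D a s) ∧
        ∀ a ∈ Y, column D a r = column D a t := by
  simp only [DB.SatDep, DB.SatEMVD, ← agree_iff]
  refine ⟨fun h s t hst => ?_, fun h s hs t ht hst => ?_⟩
  · obtain ⟨r, hr, h1⟩ := h s.1 s.2 t.1 t.2 hst
    exact ⟨⟨r, hr⟩, h1⟩
  · obtain ⟨r, h1⟩ := h ⟨s, hs⟩ ⟨t, ht⟩ hst
    exact ⟨r.1, r.2, h1⟩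

theorem latin_of_latinDeps {D : DB} {a b p : ℕ} (hap : a ≠ p) (hbp : b ≠ p)
    (h : ∀ d ∈ latinDeps a b p, D.SatDep d) :
    Latin (column D a) (column D b) (column D p) := by
  simp only [latinDeps, List.forall_mem_cons, satDep_fd_iff, satDep_emvd_iff] at h
  obtain ⟨h1, h2, h3, h4, h5, -⟩ := h
  simp [hap, hbp] at h1 h2 h3 h4 h5
  constructor
  · intro s t; exact h1 s.1 s.2 t.1 t.2
  · intro s t; exact h2 s.1 s.2 t.1 t.2
  · intro s t; exact h3 s.1 s.2 t.1 t.2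
  · intro s t
    obtain ⟨r, hr, h6⟩ := h4 s.1 s.2 t.1 t.2
    exact ⟨⟨r, hr⟩, h6⟩
  · intro s t
    obtain ⟨r, hr, h6⟩ := h5 s.1 s.2 t.1 t.2
    exact ⟨⟨r, hr⟩, h6⟩

theorem Latin.rangeFactorization {R α β γ : Type*} {x : R → α} {y : R → β} {p : R → γ}
    (h : Latin x y p) : Latin (Set.rangeFactorization x) (Set.rangeFactorization y) p := by
  obtain ⟨h1, h2, h3, h4, h5⟩ := h
  constructor <;> simpa [Set.rangeFactorization, Subtype.ext_iff] using ‹_›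

theorem exists_perm_of_presDeps {D : DB} {m : ℕ} {R : List (ℕ × ℕ)} {ε : ℕ} (hε : ε ≤ m)
    (hR : ∀ r ∈ R, r.1 ≤ m ∧ r.2 ≤ m) (hD : D.attr = presAttr m)
    (h : ∀ d ∈ presDeps m R ε, D.SatDep d) :
    ∃ (X : Type) (ρ : ℕ → Equiv.Perm X), ρ 0 = 1 ∧
      (∀ k < m, ρ (k + 1) = ρ (Nat.pair k.unpair.1 0 + 1) * ρ k.unpair.2) ∧
      (∀ r ∈ R, ρ r.1 = ρ r.2) ∧ (ρ ε = 1 → D.AlmostTrivial) := by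
  have : Nonempty D.rel := D.rel_nonempty.to_subtype
  have hbase : ∀ d ∈ baseDeps, D.SatDep d := fun d hd => h d (by simp [presDeps, hd])
  have hflat : ∀ k ≤ m, ∀ d ∈ symbolDeps k ++ [mulDep k 0 k, mulDep 0 k k], D.SatDep d := by
    intro k hk d hd
    refine h d ?_
    simp only [presDeps, List.mem_append, List.mem_flatMap]
    exact Or.inl (Or.inl (Or.inl (Or.inr ⟨k, by simpa using Nat.lt_succ_of_le hk,
      List.mem_append.1 hd⟩)))
  have hlatin : ∀ k ≤ m, Latin (column D 0) (column D 1) (column D (lineAttr 0 k)) ∧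
      Latin (column D 1) (column D 2) (column D (lineAttr 1 k)) ∧
      Latin (column D 0) (column D 2) (column D (lineAttr 2 k)) := by
    intro k hk
    refine ⟨latin_of_latinDeps ?_ ?_ fun d hd => hflat k hk d (by simp [symbolDeps, hd]),
      latin_of_latinDeps ?_ ?_ fun d hd => hflat k hk d (by simp [symbolDeps, hd]),
      latin_of_latinDeps ?_ ?_ fun d hd => hflat k hk d (by simp [symbolDeps, hd])⟩ <;>
    · unfold lineAttr; omega
  have hind : ∀ s t u, ∃ r, column D 0 r = column D 0 s ∧ column D 1 r = column D 1 t ∧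
      column D 2 r = column D 2 u := by
    intro s t u
    have h1 := (satDep_emvd_iff D _ _).1 (hbase (.emvd {1} {2}) (by simp [baseDeps])) t u (by simp)
    obtain ⟨r, hr1, hr2⟩ := h1
    have h2 := (satDep_emvd_iff D _ _).1 (hbase (.emvd {0} {1, 2}) (by simp [baseDeps])) s r
      (by simp)
    obtain ⟨r', hr3, hr4⟩ := h2
    exact ⟨r', hr3 0 (by simp), (hr4 1 (by simp)).trans (hr1 1 (by simp)),
      (hr4 2 (by simp)).trans (hr2 2 (by simp))⟩
  obtain ⟨ρ, h0, h1, h2⟩ := exists_symbol_representation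
    (x := Set.rangeFactorization (column D 0)) (y := Set.rangeFactorization (column D 1))
    (z := Set.rangeFactorization (column D 2)) (fun a => column D a) lineAttr m ε hε
    (fun u v w => mulDep u v w ∈ presDeps m R ε) Set.rangeFactorization_surjective
    Set.rangeFactorization_surjective Set.rangeFactorization_surjective
    (by
      rintro ⟨_, s, rfl⟩ ⟨_, t, rfl⟩ ⟨_, u, rfl⟩
      obtain ⟨r, h1, h2, h3⟩ := hind s t u
      exact ⟨r, Subtype.ext h1, Subtype.ext h2, Subtype.ext h3⟩)
    (fun k hk => (hlatin k hk).1.rangeFactorization)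
    (fun k hk => (hlatin k hk).2.1.rangeFactorization)
    (fun k hk => (hlatin k hk).2.2.rangeFactorization)
    (by
      intro u v w hm s t hs ht
      refine (satDep_fd_iff D _ _).1 (h _ hm) s t ?_ _ (by simp)
      simp [hs, ht])
    (fun k hk => by
      simp only [presDeps, List.mem_append, List.mem_flatMap]
      exact Or.inl (Or.inl (Or.inl (Or.inr ⟨k, by simpa using Nat.lt_succ_of_le hk, by simp⟩))))
    (fun k hk => by
      simp only [presDeps, List.mem_append, List.mem_flatMap]
      exact Or.inl (Or.inl (Or.inl (Or.inr ⟨k, by simpa using Nat.lt_succ_of_le hk, by simp⟩))))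
    (by
      intro s t hs ht
      refine Subtype.ext ((satDep_fd_iff D {lineAttr 0 0, lineAttr 0 ε} {1}).1
        (h _ (by simp [presDeps])) s t ?_ 1 (by simp))
      simp [hs, ht])
  refine ⟨_, ρ, h0, fun k hk => ?_, fun r hr => ?_, fun hρ => ?_⟩
  · refine (h1 _ _ _ ((pair_unpair_zero_le k).trans_lt hk) ((Nat.unpair_right_le k).trans hk.le)
      hk ?_).symm
    simp only [presDeps, List.mem_append, List.mem_map]
    exact Or.inl (Or.inl (Or.inr ⟨k, by simpa using hk, rfl⟩))
  · have := h1 r.1 0 r.2 (hR r hr).1 m.zero_le (hR r hr).2 (by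
      simp only [presDeps, List.mem_append, List.mem_map]
      exact Or.inl (Or.inr ⟨r, hr, rfl⟩))
    rwa [h0, mul_one] at this
  · obtain ⟨i0, i1, i2⟩ := h2 hρ
    have c0 : ∀ s t, column D 0 s = column D 0 t := fun s t =>
      congrArg Subtype.val (i0.elim ⟨_, s, rfl⟩ ⟨_, t, rfl⟩)
    have c1 : ∀ s t, column D 1 s = column D 1 t := fun s t =>
      congrArg Subtype.val (i1.elim ⟨_, s, rfl⟩ ⟨_, t, rfl⟩)
    have c2 : ∀ s t, column D 2 s = column D 2 t := fun s t =>
      congrArg Subtype.val (i2.elim ⟨_, s, rfl⟩ ⟨_, t, rfl⟩)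
    intro X Y _ _ _ hY
    refine (satDep_fd_iff D X Y).2 fun s t _ a ha => ?_
    have haU : a < 3 + 3 * (m + 1) := by
      have := hY ha
      rwa [hD, presAttr, Finset.mem_range] at this
    by_cases ha3 : a < 3
    · interval_cases a
      exacts [c0 _ _, c1 _ _, c2 _ _]
    · have hk : (a - 3) / 3 ≤ m := by omega
      have hj : (a - 3) % 3 < 3 := Nat.mod_lt _ (by omega)
      obtain ⟨l0, l1, l2⟩ := hlatin _ hk
      have e : a = lineAttr ((a - 3) % 3) ((a - 3) / 3) := by unfold lineAttr; omega
      rw [e]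
      interval_cases (a - 3) % 3
      · exact l0.pair_p _ _ (c0 _ _) (c1 _ _)
      · exact l1.pair_p _ _ (c1 _ _) (c2 _ _)
      · exact l2.pair_p _ _ (c0 _ _) (c2 _ _)

/-! ### From linear representations to databases -/

section Table

variable {V A : Type} [Nonempty V] (c : V → ℕ → A) (U : Finset ℕ) (hU : U.Nonempty)

/-- The database with attributes `U` whose tuples are the rows of a table. -/
def tableDB : DB where
  attr := U
  attr_nonempty := hU
  val _ := A
  rel := Set.range fun v a => c v a.1
  rel_nonempty := Set.range_nonempty _

/-- Satisfaction of a dependency by a table. -/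
def TableSat : Dep → Prop
  | .fd X Y => ∀ v w, (∀ a ∈ X, c v a = c w a) → ∀ a ∈ Y, c v a = c w a
  | .emvd X Y => ∀ v w, (∀ a ∈ X ∩ Y, c v a = c w a) →
      ∃ u, (∀ a ∈ X, c u a = c v a) ∧ ∀ a ∈ Y, c u a = c w a

variable {c U}

theorem tableDB_satDep {d : Dep} (hd : d.WF U) (h : TableSat c d) :
    (tableDB c U hU).SatDep d := by
  cases d with
  | fd X Y =>
    rintro _ ⟨v, rfl⟩ _ ⟨w, rfl⟩ hvw a ha
    exact h v w (fun b hb => hvw ⟨b, hd.2.2.1 hb⟩ hb) a.1 ha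
  | emvd X Y =>
    rintro _ ⟨v, rfl⟩ _ ⟨w, rfl⟩ hvw
    obtain ⟨u, hu, hu'⟩ := h v w fun b hb =>
      hvw ⟨b, hd.2.2.1 (Finset.mem_of_mem_inter_left hb)⟩ hb
    exact ⟨_, ⟨u, rfl⟩, fun a ha => hu a.1 ha, fun a ha => hu' a.1 ha⟩

end Table

/-- The columns of the table attached to a linear representation of the symbols. -/
def cell {A : Type} [AddCommGroup A] (ρ : ℕ → A ≃ₗ[ℤ] A) (v : A × A × A) : ℕ → A
  | 0 => v.1
  | 1 => v.2.1
  | 2 => v.2.2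
  | n + 3 =>
    match n % 3 with
    | 0 => v.1 - ρ (n / 3) v.2.1
    | 1 => v.2.1 - ρ (n / 3) v.2.2
    | _ => v.1 - ρ (n / 3) v.2.2

section Cell

variable {A : Type} [AddCommGroup A] (ρ : ℕ → A ≃ₗ[ℤ] A) (v : A × A × A) (k : ℕ)

@[simp] theorem cell_zero : cell ρ v 0 = v.1 := rfl
@[simp] theorem cell_one : cell ρ v 1 = v.2.1 := rfl
@[simp] theorem cell_two : cell ρ v 2 = v.2.2 := rfl

@[simp] theorem cell_lineAttr_zero : cell ρ v (lineAttr 0 k) = v.1 - ρ k v.2.1 := by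
  have h1 : 3 * k % 3 = 0 := by omega
  have h2 : 3 * k / 3 = k := by omega
  simp only [lineAttr, cell, add_zero, h1, h2]

@[simp] theorem cell_lineAttr_one : cell ρ v (lineAttr 1 k) = v.2.1 - ρ k v.2.2 := by
  have h1 : (3 * k + 1) % 3 = 1 := by omega
  have h2 : (3 * k + 1) / 3 = k := by omega
  simp only [lineAttr, cell, h1, h2]

@[simp] theorem cell_lineAttr_two : cell ρ v (lineAttr 2 k) = v.1 - ρ k v.2.2 := by
  have h1 : (3 * k + 2) % 3 = 2 := by omega
  have h2 : (3 * k + 2) / 3 = k := by omega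
  simp only [lineAttr, cell, h1, h2]

end Cell

theorem tableSat_latinDeps {V A : Type} [AddCommGroup A] {c : V → ℕ → A} {a b p : ℕ}
    (σ : A ≃ₗ[ℤ] A) (hp : ∀ v, c v p = c v a - σ (c v b))
    (hex : ∀ x y, ∃ v, c v a = x ∧ c v b = y) : ∀ d ∈ latinDeps a b p, TableSat c d := by
  simp only [latinDeps, List.forall_mem_cons, TableSat]
  refine ⟨?_, ?_, ?_, ?_, ?_, by simp⟩
  · intro v w h
    simp_all
  · intro v w h
    simp only [Finset.mem_insert, Finset.mem_singleton, forall_eq_or_imp, forall_eq, hp] at h ⊢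
    exact σ.injective (sub_right_injective (h.1 ▸ h.2))
  · intro v w h
    simp only [Finset.mem_insert, Finset.mem_singleton, forall_eq_or_imp, forall_eq, hp] at h ⊢
    exact sub_left_injective (h.1 ▸ h.2)
  · intro v w _
    obtain ⟨u, hu1, hu2⟩ := hex (c v a) (σ.symm (c v a - c w p))
    exact ⟨u, by simp [hu1], by simp [hp u, hu1, hu2]⟩
  · intro v w _
    obtain ⟨u, hu1, hu2⟩ := hex (c w p + σ (c v b)) (c v b)
    exact ⟨u, by simp [hu2], by simp [hp u, hu1, hu2]⟩

theorem exists_db_of_representation {A : Type} [AddCommGroup A] [Finite A] [Nontrivial A]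
    (htor : ∀ a b : A, a + a = b + b → a = b) {m : ℕ} {R : List (ℕ × ℕ)} {ε : ℕ} (hε : ε ≤ m)
    (hR : ∀ r ∈ R, r.1 ≤ m ∧ r.2 ≤ m) (ρ : ℕ → A ≃ₗ[ℤ] A) (h0 : ρ 0 = 1)
    (hcons : ∀ k < m, ρ (k + 1) = ρ (Nat.pair k.unpair.1 0 + 1) * ρ k.unpair.2)
    (hrel : ∀ r ∈ R, ρ r.1 = ρ r.2) (hneg : ∀ a, ρ ε a = -a) :
    ∃ D : DB, D.attr = presAttr m ∧ D.IsFinite ∧ (∀ d ∈ presDeps m R ε, D.SatDep d) ∧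
      ¬ D.AlmostTrivial := by
  have hU : (presAttr m).Nonempty := ⟨0, by simp [presAttr]⟩
  refine ⟨tableDB (cell ρ) (presAttr m) hU, rfl, fun _ => inferInstanceAs (Finite A),
    fun d hd => tableDB_satDep hU (presDeps_wf hε hR d hd) ?_, fun h => ?_⟩
  · have hmul : ∀ u v w, ρ w = ρ u * ρ v → TableSat (cell ρ) (mulDep u v w) := by
      intro u v w hw s t h
      simp only [Finset.mem_insert, Finset.mem_singleton, forall_eq_or_imp, forall_eq,
        cell_lineAttr_zero, cell_lineAttr_one, cell_lineAttr_two, hw, LinearEquiv.mul_apply] at h ⊢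
      have e : ∀ s : A × A × A, s.1 - ρ u (ρ v s.2.2) =
          (s.1 - ρ u s.2.1) + ρ u (s.2.1 - ρ v s.2.2) := by
        intro s; rw [map_sub]; abel
      rw [e s, e t, h.1, h.2]
    simp only [presDeps, List.mem_append, List.mem_flatMap, List.mem_map, List.mem_range,
      List.mem_cons, List.not_mem_nil, or_false, symbolDeps, baseDeps] at hd
    rcases hd with ((((rfl | rfl) | ⟨k, hk, ((h | h) | h) | rfl | rfl⟩) | ⟨k, hk, rfl⟩) |
      ⟨r, hr, rfl⟩) | rfl
    · exact fun v w _ => ⟨(v.1, v.2.1, w.2.2), by simp, by simp⟩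
    · exact fun v w _ => ⟨(v.1, w.2.1, w.2.2), by simp, by simp⟩
    · exact tableSat_latinDeps (ρ k) (by simp) (fun x y => ⟨(x, y, 0), rfl, rfl⟩) d h
    · exact tableSat_latinDeps (ρ k) (by simp) (fun x y => ⟨(0, x, y), rfl, rfl⟩) d h
    · exact tableSat_latinDeps (ρ k) (by simp) (fun x y => ⟨(x, 0, y), rfl, rfl⟩) d h
    · exact hmul _ _ _ (by rw [h0, mul_one])
    · exact hmul _ _ _ (by rw [h0, one_mul])
    · exact hmul _ _ _ (hcons k hk)
    · exact hmul _ _ _ (by rw [h0, mul_one, hrel r hr])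
    · intro v w h
      simp only [Finset.mem_insert, Finset.mem_singleton, forall_eq_or_imp, forall_eq,
        cell_lineAttr_zero, h0, LinearEquiv.coe_one, id_eq, hneg, cell_one] at h ⊢
      refine htor _ _ ?_
      have e : ∀ s : A × A × A, s.2.1 + s.2.1 = (s.1 - -s.2.1) - (s.1 - s.2.1) := by
        intro s; abel
      rw [e v, e w, h.1, h.2]
  · obtain ⟨a, ha⟩ := exists_ne (0 : A)
    have := h {0} {1} (by simp) (by simp) (by simp [tableDB, presAttr])
      (by simp [tableDB, presAttr]; omega) _ ⟨(0, 0, 0), rfl⟩ _ ⟨(0, a, 0), rfl⟩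
      (by rintro ⟨x, hx⟩ hx0; simp at hx0; subst hx0; rfl)
      ⟨1, by simp [tableDB, presAttr]; omega⟩ (by simp)
    exact ha this.symm

section Coding

open Encodable

/-! ### Computability of the codes -/

theorem sort_spec {α : Type*} (s : Multiset α) (r : α → α → Prop) (i : DecidableRel r)
    (i1 : IsTrans α r) (i2 : Std.Antisymm r) (i3 : Std.Total r) :
    (↑(s.sort r) : Multiset α) = s ∧ (s.sort r).Pairwise r :=
  ⟨Multiset.sort_eq _ _, Multiset.pairwise_sort _ _⟩

theorem encode_finset_of_sorted {s : Finset ℕ} (l : List ℕ) (hl : l.Pairwise (· < ·))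
    (h : l.toFinset = s) : encode s = encode l := by
  have h' : ∃ l' : List ℕ, encode s = encode l' ∧ (l' : Multiset ℕ) = s.1 ∧
     l'.Pairwise (· ≤ ·) :=
    ⟨_, rfl, sort_spec _ _ _ _ _ _⟩
  obtain ⟨l', h1, h2, h3⟩ := h'
  rw [h1]
  congr 1
  refine List.Perm.eq_of_pairwise' h3 (hl.imp le_of_lt) ?_
  rw [← Multiset.coe_eq_coe, h2, ← h, List.toFinset_val, List.dedup_eq_self.2 hl.nodup]

theorem encode_range (n : ℕ) : encode (Finset.range n) = encode (List.range n) :=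
  encode_finset_of_sorted _ List.pairwise_lt_range (by ext; simp)

theorem encode_singleton (a : ℕ) : encode ({a} : Finset ℕ) = encode [a] :=
  encode_finset_of_sorted _ (by simp) (by simp)

theorem encode_pair (a b : ℕ) : encode ({a, b} : Finset ℕ) =
    if a < b then encode [a, b] else if b < a then encode [b, a] else encode [a] := by
  split_ifs with h1 h2
  · exact encode_finset_of_sorted _ (by simpa using h1) (by simp)
  · exact encode_finset_of_sorted _ (by simpa using h2) (by simp [Finset.pair_comm])
  · obtain rfl : a = b := by omega
    exact encode_finset_of_sorted _ (by simp) (by simp)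

section

variable {α : Type*} [Primcodable α]

theorem primrec_singleton {f : α → ℕ} (hf : Primrec f) : Primrec fun x => [f x] :=
  Primrec.list_cons.comp hf (Primrec.const [])

theorem primrec_encode_singleton {f : α → ℕ} (hf : Primrec f) :
    Primrec fun x => encode ({f x} : Finset ℕ) :=
  (Primrec.encode.comp (primrec_singleton hf)).of_eq fun _ => (encode_singleton _).symm

theorem primrec_encode_pair {f g : α → ℕ} (hf : Primrec f) (hg : Primrec g) :
    Primrec fun x => encode ({f x, g x} : Finset ℕ) := by
  refine (Primrec.ite (Primrec.nat_lt.comp hf hg)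
    (Primrec.encode.comp (Primrec.list_cons.comp hf (primrec_singleton hg)))
    (Primrec.ite (Primrec.nat_lt.comp hg hf)
      (Primrec.encode.comp (Primrec.list_cons.comp hg (primrec_singleton hf)))
      (Primrec.encode.comp (primrec_singleton hf)))).of_eq fun x => (encode_pair _ _).symm

theorem primrec_fd {X Y : α → Finset ℕ} (hX : Primrec fun x => encode (X x))
    (hY : Primrec fun x => encode (Y x)) : Primrec fun x => (Dep.fd (X x) (Y x)).code :=
  Primrec.nat_mul.comp (Primrec.const 2) (Primrec₂.natPair.comp hX hY)

theorem primrec_emvd {X Y : α → Finset ℕ} (hX : Primrec fun x => encode (X x))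
    (hY : Primrec fun x => encode (Y x)) : Primrec fun x => (Dep.emvd (X x) (Y x)).code :=
  Primrec.succ.comp (primrec_fd hX hY)

theorem primrec_lineAttr (j : ℕ) {f : α → ℕ} (hf : Primrec f) :
    Primrec fun x => lineAttr j (f x) :=
  Primrec.nat_add.comp (Primrec.nat_add.comp (Primrec.nat_mul.comp (Primrec.const 3) hf)
    (Primrec.const j)) (Primrec.const 3)

theorem primrec_latinDeps (a b : ℕ) {p : α → ℕ} (hp : Primrec p) :
    Primrec fun x => (latinDeps a b (p x)).map Dep.code := by
  have ha := Primrec.const (α := α) a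
  have hb := Primrec.const (α := α) b
  exact Primrec.list_cons.comp
    (primrec_fd (primrec_encode_pair ha hb) (primrec_encode_singleton hp)) <|
    Primrec.list_cons.comp
      (primrec_fd (primrec_encode_pair ha hp) (primrec_encode_singleton hb)) <|
    Primrec.list_cons.comp
      (primrec_fd (primrec_encode_pair hb hp) (primrec_encode_singleton ha)) <|
    Primrec.list_cons.comp
      (primrec_emvd (primrec_encode_singleton ha) (primrec_encode_singleton hp)) <|
    primrec_singleton (primrec_emvd (primrec_encode_singleton hb) (primrec_encode_singleton hp))

theorem primrec_mulDep {u v w : α → ℕ} (hu : Primrec u) (hv : Primrec v) (hw : Primrec w) :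
    Primrec fun x => (mulDep (u x) (v x) (w x)).code :=
  primrec_fd (primrec_encode_pair (primrec_lineAttr 0 hu) (primrec_lineAttr 1 hv))
    (primrec_encode_singleton (primrec_lineAttr 2 hw))

end

theorem primrec_symbolDeps : Primrec fun k =>
    (symbolDeps k ++ [mulDep k 0 k, mulDep 0 k k]).map Dep.code := by
  have h0 := Primrec.const (α := ℕ) 0
  refine (Primrec.list_append.comp (Primrec.list_append.comp (Primrec.list_append.comp
    (primrec_latinDeps 0 1 (primrec_lineAttr 0 Primrec.id))
    (primrec_latinDeps 1 2 (primrec_lineAttr 1 Primrec.id)))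
    (primrec_latinDeps 0 2 (primrec_lineAttr 2 Primrec.id)))
    (Primrec.list_cons.comp (primrec_mulDep Primrec.id h0 Primrec.id)
      (primrec_singleton (primrec_mulDep h0 Primrec.id Primrec.id)))).of_eq fun k => ?_
  simp [symbolDeps]

theorem primrec_consDep : Primrec fun k => (consDep k).code :=
  primrec_mulDep (Primrec.succ.comp (Primrec₂.natPair.comp
    (Primrec.fst.comp Primrec.unpair) (Primrec.const 0)))
    (Primrec.snd.comp Primrec.unpair) Primrec.succ

theorem primrec_depInputCode (ε : ℕ) : Primrec fun p : ℕ × List (ℕ × ℕ) =>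
    depInputCode (presAttr p.1) (presDeps p.1 p.2 ε) := by
  have hR : Primrec fun r : ℕ × ℕ => (mulDep r.1 0 r.2).code :=
    primrec_mulDep Primrec.fst (Primrec.const 0) Primrec.snd
  refine (Primrec₂.natPair.comp
    (Primrec.encode.comp (Primrec.list_range.comp (Primrec.nat_add.comp (Primrec.const 3)
      (Primrec.nat_mul.comp (Primrec.const 3) (Primrec.succ.comp Primrec.fst)))))
    (Primrec.encode.comp
      (Primrec.list_append.comp (Primrec.list_append.comp (Primrec.list_append.comp
        (Primrec.list_append.comp (Primrec.const (baseDeps.map Dep.code))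
          (Primrec.list_flatMap (Primrec.list_range.comp (Primrec.succ.comp Primrec.fst))
            (primrec_symbolDeps.comp Primrec.snd).to₂))
        (Primrec.list_map (Primrec.list_range.comp Primrec.fst)
          (primrec_consDep.comp Primrec.snd).to₂))
        (Primrec.list_map Primrec.snd (hR.comp Primrec.snd).to₂))
        (Primrec.const [(Dep.fd {lineAttr 0 0, lineAttr 0 ε} {1}).code])))).of_eq fun p => ?_
  simp only [depInputCode, presAttr, encode_range, presDeps, List.map_append, List.map_flatMap,
    List.map_map, Function.comp_def, List.map_cons, List.map_nil]

end Coding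

/-! ### Stack machines -/

/-- The transition function of a stack machine with states `Q`, stacks `K` and stack alphabet `Γ`:
a non-halting state pops one stack, and depending on the result (`none` on the empty stack) goes
to a new state and pushes a word on the same stack. -/
abbrev Trans (Q K Γ : Type) := Q → Option (K × (Option Γ → Q × List Γ))

section Machine

variable {Q K Γ : Type} [DecidableEq K]

/-- One step of a stack machine. -/
def stepCfg (δ : Trans Q K Γ) (c : Q × (K → List Γ)) : Option (Q × (K → List Γ)) :=
  (δ c.1).map fun p => ((p.2 (c.2 p.1).head?).1,
    update c.2 p.1 ((p.2 (c.2 p.1).head?).2 ++ (c.2 p.1).tail))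

variable (Q K Γ) in
/-- Letters on the stacks: the extra stack `none` records the history of the computation, and
`Sum.inl none` marks the bottom of the other stacks. -/
abbrev Letter := Option K × (Option Γ ⊕ Q × Option Γ)

/-- The content of the stack `j` in a list of letters. -/
def proj (j : Option K) (ls : List (Letter Q K Γ)) : List (Option Γ ⊕ Q × Option Γ) :=
  ls.filterMap fun a => if a.1 = j then some a.2 else none

@[simp] theorem proj_nil (j : Option K) : proj j ([] : List (Letter Q K Γ)) = [] := rfl

theorem proj_cons (j : Option K) (a : Letter Q K Γ) (ls : List (Letter Q K Γ)) :
    proj j (a :: ls) = if a.1 = j then a.2 :: proj j ls else proj j ls := by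
  by_cases h : a.1 = j <;> simp [proj, h]

@[simp] theorem proj_append (j : Option K) (ls ls' : List (Letter Q K Γ)) :
    proj j (ls ++ ls') = proj j ls ++ proj j ls' := by
  simp [proj]

/-- The content of a stack, with a bottom marker. -/
def encStack (l : List Γ) : List (Option Γ ⊕ Q × Option Γ) :=
  l.map (fun x => Sum.inl (some x)) ++ [Sum.inl none]

/-- The letters replacing the top `o` of the stack `k` when `l` is pushed in the state `q`. -/
def ruleLetters (q : Q) (k : K) (o : Option Γ) (l : List Γ) : List (Letter Q K Γ) :=
  l.map (fun x => (some k, Sum.inl (some x))) ++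
    o.elim [(some k, Sum.inl none)] (fun _ => []) ++ [(none, Sum.inr (q, o))]

end Machine

/-! ### The group relations attached to a machine -/

/-- Generators over states `Q` and letters `A`. The generators `T` and `G` come in two copies,
indexed by the first Boolean; the last Boolean of `G` and `D` marks formal inverses. -/
inductive Gen (Q A : Type) : Type
  | T (b : Bool) (q : Q) : Gen Q A
  | G (b : Bool) (a : A) (i : Bool) : Gen Q A
  | D (i : Bool) : Gen Q A
  | M : Gen Q A
  | E : Gen Q A

namespace Gen

variable {Q A : Type}

/-- The generators of a copy, without formal inverses. -/
def copy (b : Bool) : Q ⊕ A → Gen Q A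
  | .inl q => T b q
  | .inr a => G b a false

/-- The word obtained from `w` by successively replacing `w` by `w * a⁻¹ * w * a`. -/
def commWord (w : List (Gen Q A)) (ls : List A) : List (Gen Q A) :=
  ls.foldl (fun w a => w ++ [G true a true] ++ w ++ [G true a false]) w

instance [Finite Q] [Finite A] : Finite (Gen Q A) := by
  let f : Bool × Q ⊕ Bool × A × Bool ⊕ Bool ⊕ Bool → Gen Q A
    | .inl (b, q) => T b q
    | .inr (.inl (b, a, i)) => G b a i
    | .inr (.inr (.inl i)) => D i
    | .inr (.inr (.inr true)) => M
    | .inr (.inr (.inr false)) => E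
  refine Finite.of_surjective f fun x => ?_
  cases x with
  | T b q => exact ⟨.inl (b, q), rfl⟩
  | G b a i => exact ⟨.inr (.inl (b, a, i)), rfl⟩
  | D i => exact ⟨.inr (.inr (.inl i)), rfl⟩
  | M => exact ⟨.inr (.inr (.inr true)), rfl⟩
  | E => exact ⟨.inr (.inr (.inr false)), rfl⟩

end Gen

open Gen

/-- The value of a word in a group. -/
def wordEval {Q A G : Type} [Group G] (γ : Gen Q A → G) (w : List (Gen Q A)) : G :=
  (w.map γ).prod

section Relations

variable {Q K Γ : Type}

/-- The pairs of words whose equality encodes the transitions of a machine. -/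
def ruleWords (δ : Trans Q K Γ) (p : Q × Option Γ) :
    List (Gen Q (Letter Q K Γ)) × List (Gen Q (Letter Q K Γ)) :=
  match δ p.1 with
  | none => ([], [])
  | some (k, f) => (commWord [T true p.1] [(some k, Sum.inl p.2)],
      commWord [T true (f p.2).1] (ruleLetters p.1 k p.2 (f p.2).2))

/-- The relations attached to a machine which do not depend on its input. -/
inductive MachineRel (δ : Trans Q K Γ) (acc : Q) :
    List (Gen Q (Letter Q K Γ)) × List (Gen Q (Letter Q K Γ)) → Prop
  | inv_G (b a i) : MachineRel δ acc ([G b a i, G b a !i], [])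
  | inv_D (i) : MachineRel δ acc ([D i, D !i], [])
  | comm (x y) : MachineRel δ acc ([copy false x, copy true y], [copy true y, copy false x])
  | d_T1 (q) : MachineRel δ acc ([D false, T false q], [T false q, T true q, D false])
  | d_T2 (q) : MachineRel δ acc ([D false, T true q], [T true q, D false])
  | d_G (a) : MachineRel δ acc
      ([D false, G false a false, G true a false], [G false a false, G true a false, D false])
  | comm_G (a b) (h : a.1 ≠ b.1) : MachineRel δ acc
      ([G true a false, G true b false], [G true b false, G true a false])
  | rule (p) : MachineRel δ acc (ruleWords δ p)
  | accept : MachineRel δ acc ([T true acc], [])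

theorem finite_machineRel [Finite Q] [Finite K] [Finite Γ] (δ : Trans Q K Γ) (acc : Q) :
    {p | MachineRel δ acc p}.Finite := by
  let L := Letter Q K Γ
  let f : (Bool × L × Bool) ⊕ Bool ⊕ ((Q ⊕ L) × (Q ⊕ L)) ⊕ Q ⊕ Q ⊕ L ⊕ (L × L) ⊕
      (Q × Option Γ) ⊕ Unit → List (Gen Q L) × List (Gen Q L)
    | .inl (b, a, i) => ([G b a i, G b a !i], [])
    | .inr (.inl i) => ([D i, D !i], [])
    | .inr (.inr (.inl (x, y))) => ([copy false x, copy true y], [copy true y, copy false x])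
    | .inr (.inr (.inr (.inl q))) => ([D false, T false q], [T false q, T true q, D false])
    | .inr (.inr (.inr (.inr (.inl q)))) => ([D false, T true q], [T true q, D false])
    | .inr (.inr (.inr (.inr (.inr (.inl a))))) =>
      ([D false, G false a false, G true a false], [G false a false, G true a false, D false])
    | .inr (.inr (.inr (.inr (.inr (.inr (.inl (a, b))))))) =>
      ([G true a false, G true b false], [G true b false, G true a false])
    | .inr (.inr (.inr (.inr (.inr (.inr (.inr (.inl p))))))) => ruleWords δ p
    | .inr (.inr (.inr (.inr (.inr (.inr (.inr (.inr _))))))) => ([T true acc], [])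
  refine (Set.finite_range f).subset fun p hp => ?_
  cases hp with
  | inv_G b a i => exact ⟨.inl (b, a, i), rfl⟩
  | inv_D i => exact ⟨.inr (.inl i), rfl⟩
  | comm x y => exact ⟨.inr (.inr (.inl (x, y))), rfl⟩
  | d_T1 q => exact ⟨.inr (.inr (.inr (.inl q))), rfl⟩
  | d_T2 q => exact ⟨.inr (.inr (.inr (.inr (.inl q)))), rfl⟩
  | d_G a => exact ⟨.inr (.inr (.inr (.inr (.inr (.inl a))))), rfl⟩
  | comm_G a b h => exact ⟨.inr (.inr (.inr (.inr (.inr (.inr (.inl (a, b))))))), rfl⟩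
  | rule p => exact ⟨.inr (.inr (.inr (.inr (.inr (.inr (.inr (.inl p))))))), rfl⟩
  | accept => exact ⟨.inr (.inr (.inr (.inr (.inr (.inr (.inr (.inr ()))))))), rfl⟩

end Relations

/-! ### Accepting computations trivialise the group relations -/

section Derivation

variable {Q K Γ H : Type} [Group H]

/-- `t * a⁻¹ * t * a`. -/
def dbl (g : H) (t : H) : H := t * (g⁻¹ * t * g)

/-- Pairs of corresponding elements of the two copies. -/
inductive CopyPair {A : Type} (γ : Gen Q A → H) : H → H → Prop
  | base (q) : CopyPair γ (γ (T false q)) (γ (T true q))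
  | conj (a) {s t} : CopyPair γ s t →
    CopyPair γ ((γ (G false a false))⁻¹ * s * γ (G false a false))
      ((γ (G true a false))⁻¹ * t * γ (G true a false))
  | mul {s t s' t'} : CopyPair γ s t → CopyPair γ s' t' → CopyPair γ (s * s') (t * t')

/-- The map `γ` on generators satisfies the relations attached to a machine. -/
def Models (δ : Trans Q K Γ) (acc : Q) (γ : Gen Q (Letter Q K Γ) → H) : Prop :=
  ∀ p, MachineRel δ acc p → wordEval γ p.1 = wordEval γ p.2

variable {δ : Trans Q K Γ} {acc : Q} {γ : Gen Q (Letter Q K Γ) → H}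

theorem commute_copy (hγ : Models δ acc γ) (x y) :
    Commute (γ (copy false x)) (γ (copy true y)) := by
  simpa [wordEval, Commute, SemiconjBy] using hγ _ (.comm x y)

theorem eval_inv (hγ : Models δ acc γ) (a) : γ (G true a true) = (γ (G true a false))⁻¹ := by
  rw [eq_inv_iff_mul_eq_one]
  simpa [wordEval] using hγ _ (.inv_G true a true)

theorem CopyPair.commute_left (hγ : Models δ acc γ) {s t : H} (h : CopyPair γ s t) (y) :
    Commute s (γ (copy true y)) := by
  induction h with
  | base q => exact commute_copy hγ (.inl q) y
  | conj a _ ih =>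
    have := commute_copy hγ (.inr a) y
    exact (this.inv_left.mul_left ih).mul_left this
  | mul _ _ ih ih' => exact ih.mul_left ih'

theorem CopyPair.commute_right (hγ : Models δ acc γ) {s t : H} (h : CopyPair γ s t) (x) :
    Commute (γ (copy false x)) t := by
  induction h with
  | base q => exact commute_copy hγ x (.inl q)
  | conj a _ ih =>
    have := commute_copy hγ x (.inr a)
    exact (this.inv_right.mul_right ih).mul_right this
  | mul _ _ ih ih' => exact ih.mul_right ih'

theorem CopyPair.commute_left_right (hγ : Models δ acc γ) {s t s' t' : H} (h : CopyPair γ s t)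
    (h' : CopyPair γ s' t') : Commute s t' := by
  induction h' with
  | base q => exact h.commute_left hγ (.inl q)
  | conj a _ ih =>
    have := h.commute_left hγ (.inr a)
    exact (this.inv_right.mul_right ih).mul_right this
  | mul _ _ ih ih' => exact ih.mul_right ih'

theorem CopyPair.d_relations (hγ : Models δ acc γ) {s t : H} (h : CopyPair γ s t) :
    γ (D false) * s = s * t * γ (D false) ∧ Commute (γ (D false)) t := by
  induction h with
  | base q =>
    constructor
    · simpa [wordEval, mul_assoc] using hγ _ (.d_T1 q)
    · simpa [wordEval, Commute, SemiconjBy] using hγ _ (.d_T2 q)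
  | @conj a s t hst ih =>
    set d := γ (D false)
    set g := γ (G false a false)
    set g' := γ (G true a false)
    have hd : Commute d (g * g') := by
      simpa [wordEval, mul_assoc, Commute, SemiconjBy] using hγ _ (.d_G a)
    have hconj : ∀ x : H, (g * g')⁻¹ * x * (g * g') = g'⁻¹ * (g⁻¹ * x * g) * g' := by
      intro x; group
    have hs : g⁻¹ * s * g = (g * g')⁻¹ * s * (g * g') := by
      have h1 : Commute s g' := hst.commute_left hγ (.inr a)
      have h2 : Commute g g' := commute_copy hγ (.inr a) (.inr a)
      have h3 : Commute g' (g⁻¹ * s * g) := (h2.symm.inv_right.mul_right h1.symm).mul_right h2.symm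
      rw [hconj, h3.inv_mul_cancel]
    have ht : g'⁻¹ * t * g' = (g * g')⁻¹ * t * (g * g') := by
      have h1 : Commute g t := hst.commute_right hγ (.inr a)
      rw [hconj, h1.inv_mul_cancel]
    rw [hs, ht]
    generalize g * g' = h at hd
    refine ⟨?_, (hd.inv_right.mul_right ih.2).mul_right hd⟩
    calc d * (h⁻¹ * s * h) = (d * h⁻¹) * s * h := by group
      _ = h⁻¹ * (d * s) * h := by rw [hd.inv_right.eq]; group
      _ = h⁻¹ * s * t * (d * h) := by rw [ih.1]; group
      _ = h⁻¹ * s * h * (h⁻¹ * t * h) * d := by rw [hd.eq]; group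
  | @mul s t s' t' h1 h2 ih ih' =>
    refine ⟨?_, ih.2.mul_right ih'.2⟩
    rw [← mul_assoc, ih.1, mul_assoc _ (γ (D false)), ih'.1, mul_assoc s t, ← mul_assoc t,
      ← mul_assoc t, (h2.commute_left_right hγ h1).symm.eq]
    group

theorem CopyPair.commute_right_right (hγ : Models δ acc γ) {s t s' t' : H} (h : CopyPair γ s t)
    (h' : CopyPair γ s' t') : Commute t t' := by
  obtain ⟨h1, -⟩ := h.d_relations hγ
  obtain ⟨-, h2⟩ := h'.d_relations hγ
  have h3 := h.commute_left_right hγ h'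
  have h4 : s * t = γ (D false) * s * (γ (D false))⁻¹ := by rw [h1]; group
  have h5 : Commute (s * t) t' := by
    rw [h4]
    exact (h2.mul_left h3).mul_left h2.inv_left
  have : t = s⁻¹ * (s * t) := by group
  rw [this]
  exact h3.inv_left.mul_left h5

theorem CopyPair.dbl {s t : H} (h : CopyPair γ s t) (a) :
    ∃ s', CopyPair γ s' (dbl (γ (G true a false)) t) :=
  ⟨_, h.mul (h.conj a)⟩

theorem CopyPair.dbl_comm (hγ : Models δ acc γ) {s t : H} (h : CopyPair γ s t)
    {a b : Letter Q K Γ} (hab : a.1 ≠ b.1) :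
    DBConsistency.dbl (γ (G true a false)) (DBConsistency.dbl (γ (G true b false)) t) =
      DBConsistency.dbl (γ (G true b false)) (DBConsistency.dbl (γ (G true a false)) t) := by
  have h1 : Commute (γ (G true a false)) (γ (G true b false)) := by
    simpa [wordEval, Commute, SemiconjBy] using hγ _ (.comm_G a b hab)
  have h2 := (h.conj a).commute_right_right hγ (h.conj b)
  unfold DBConsistency.dbl
  set x := γ (G true a false)
  set y := γ (G true b false)
  calc t * (y⁻¹ * t * y) * (x⁻¹ * (t * (y⁻¹ * t * y)) * x)
      = t * ((y⁻¹ * t * y) * (x⁻¹ * t * x)) * ((y * x)⁻¹ * t * (y * x)) := by group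
    _ = t * ((x⁻¹ * t * x) * (y⁻¹ * t * y)) * ((x * y)⁻¹ * t * (x * y)) := by
      rw [h1.eq, h2.eq]
    _ = _ := by group

/-- The value of a state element under a list of letters. -/
def dblList (γ : Gen Q (Letter Q K Γ) → H) (t : H) (ls : List (Letter Q K Γ)) : H :=
  ls.foldl (fun t a => dbl (γ (G true a false)) t) t

theorem wordEval_append (u v : List (Gen Q (Letter Q K Γ))) :
    wordEval γ (u ++ v) = wordEval γ u * wordEval γ v := by
  simp [wordEval]

theorem wordEval_commWord (hγ : ∀ a, γ (G true a true) = (γ (G true a false))⁻¹)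
    (w : List (Gen Q (Letter Q K Γ))) (ls : List (Letter Q K Γ)) :
    wordEval γ (commWord w ls) = dblList γ (wordEval γ w) ls := by
  induction ls generalizing w with
  | nil => rfl
  | cons a ls ih =>
    change wordEval γ (commWord _ ls) = dblList γ _ ls
    rw [ih]
    congr 1
    simp only [wordEval_append, dbl]
    simp [wordEval, hγ, mul_assoc]

theorem dblList_one (ls : List (Letter Q K Γ)) : dblList γ 1 ls = 1 := by
  induction ls with
  | nil => rfl
  | cons a ls ih => simpa [dblList, dbl] using ih

theorem dblList_append (t : H) (ls ls' : List (Letter Q K Γ)) :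
    dblList γ t (ls ++ ls') = dblList γ (dblList γ t ls) ls' := by
  simp [dblList]

variable [DecidableEq K]

theorem exists_dblList_eq (hγ : Models δ acc γ) {j : Option K} {x} {r}
    {ls : List (Letter Q K Γ)} (hls : proj j ls = x :: r) :
    ∃ ls', proj j ls' = r ∧ (∀ j' ≠ j, proj j' ls' = proj j' ls) ∧
      ∀ s t, CopyPair γ s t → dblList γ t ls = dblList γ t ((j, x) :: ls') := by
  induction ls with
  | nil => simp at hls
  | cons b ls ih =>
    rw [proj_cons] at hls
    by_cases hb : b.1 = j
    · rw [if_pos hb] at hls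
      obtain ⟨rfl, rfl⟩ := List.cons.inj hls
      subst hb
      refine ⟨ls, rfl, fun j' hj' => ?_, fun s t _ => rfl⟩
      rw [proj_cons, if_neg hj'.symm]
    · rw [if_neg hb] at hls
      obtain ⟨ls', h1, h2, h3⟩ := ih hls
      refine ⟨b :: ls', ?_, fun j' hj' => ?_, fun s t hst => ?_⟩
      · rw [proj_cons, if_neg hb, h1]
      · rw [proj_cons, proj_cons, h2 j' hj']
      · obtain ⟨s', hs'⟩ := hst.dbl b
        change dblList γ (dbl _ t) ls = dblList γ (dbl _ (dbl _ t)) ls'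
        rw [h3 _ _ hs', hst.dbl_comm hγ hb]
        rfl

/-- A list of letters represents the stacks of a configuration. -/
def Represents (ls : List (Letter Q K Γ)) (S : K → List Γ) : Prop :=
  ∀ k, proj (some k) ls = encStack (S k)

theorem proj_ruleLetters (q : Q) (k k' : K) (o : Option Γ) (l : List Γ) :
    proj (some k') (ruleLetters q k o l) = if k = k' then
      l.map (fun x => Sum.inl (some x)) ++ o.elim [Sum.inl none] (fun _ => []) else [] := by
  have h : ∀ l : List Γ, proj (some k')
      (l.map (fun x => ((some k, Sum.inl (some x)) : Letter Q K Γ))) =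
      if k = k' then l.map (fun x => Sum.inl (some x)) else [] := by
    intro l
    induction l with
    | nil => simp
    | cons a l ih =>
      rw [List.map_cons, proj_cons, ih]
      by_cases hk : k = k' <;> simp [hk]
  simp only [ruleLetters, proj_append, h]
  cases o <;> by_cases hk : k = k' <;> simp [hk, proj_cons]

theorem dblList_step (hγ : Models δ acc γ) {q q' : Q} {S S' : K → List Γ}
    (hstep : stepCfg δ (q, S) = some (q', S')) {ls} (hls : Represents ls S) :
    ∃ ls', Represents ls' S' ∧ dblList γ (γ (T true q)) ls = dblList γ (γ (T true q')) ls' := by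
  obtain ⟨⟨k, f⟩, hδ, hqS⟩ := Option.map_eq_some_iff.1 hstep
  obtain ⟨hq', hS'⟩ := Prod.mk.inj hqS
  dsimp only at hδ hq' hS'
  set o := (S k).head? with ho
  obtain ⟨r, hr⟩ : ∃ r, proj (some k) ls = Sum.inl o :: r ∧
      o.elim [Sum.inl none] (fun _ => []) ++ r = encStack (S k).tail := by
    rw [hls k, ho]
    cases S k with
    | nil => exact ⟨[], rfl, rfl⟩
    | cons a l => exact ⟨encStack l, rfl, rfl⟩
  obtain ⟨ls', h1, h2, h3⟩ := exists_dblList_eq hγ hr.1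
  have hrule := hγ _ (.rule (q, o))
  simp only [ruleWords, hδ] at hrule
  rw [wordEval_commWord (eval_inv hγ), wordEval_commWord (eval_inv hγ)] at hrule
  refine ⟨ruleLetters q k o (f o).2 ++ ls', fun k' => ?_, ?_⟩
  · rw [proj_append, proj_ruleLetters, ← hS']
    by_cases hk : k = k'
    · subst hk
      rw [if_pos rfl, h1, update_self, List.append_assoc, hr.2]
      simp [encStack]
    · rw [if_neg hk, h2 _ (by simpa using Ne.symm hk), update_of_ne (Ne.symm hk), hls k']
      rfl
  · rw [h3 _ _ (.base q), dblList_append, ← hq']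
    simp only [wordEval, List.map_cons, List.map_nil, List.prod_singleton] at hrule
    rw [← hrule]
    rfl

theorem dblList_eq_one_of_reaches (hγ : Models δ acc γ) {c : Q × (K → List Γ)} {S : K → List Γ}
    (h : StateTransition.Reaches (stepCfg δ) c (acc, S)) {ls} (hls : Represents ls c.2) :
    dblList γ (γ (T true c.1)) ls = 1 := by
  have hacc : γ (T true acc) = 1 := by simpa [wordEval] using hγ _ .accept
  obtain ⟨ls', -, h1⟩ : ∃ ls', Represents ls' S ∧
      dblList γ (γ (T true c.1)) ls = dblList γ (γ (T true acc)) ls' := by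
    clear hacc
    induction h using Relation.ReflTransGen.head_induction_on generalizing ls with
    | refl => exact ⟨ls, hls, rfl⟩
    | @head c c' hc _ ih =>
      obtain ⟨ls', h1, h2⟩ := dblList_step hγ (q := c.1) (S := c.2) (q' := c'.1) (S' := c'.2) hc hls
      obtain ⟨ls'', h3, h4⟩ := ih h1
      exact ⟨ls'', h3, h2.trans h4⟩
  rw [h1, hacc, dblList_one]

end Derivation

/-! ### Linear models from shift operators -/

section Shift

/-- The linear permutation representation over `ZMod 3`. -/
def permRep (X : Type) : Equiv.Perm X →* ((X → ZMod 3) ≃ₗ[ℤ] (X → ZMod 3)) where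
  toFun σ := LinearEquiv.funCongrLeft ℤ (ZMod 3) σ⁻¹
  map_one' := rfl
  map_mul' _ _ := rfl

theorem permRep_apply {X : Type} (σ : Equiv.Perm X) (f : X → ZMod 3) (v : X) :
    permRep X σ f v = f (σ⁻¹ v) := rfl

/-- Multiplication by a sign depending on the value of a function in `ZMod 2`. -/
def signMul {X : Type} (χ : X → ZMod 2) : (X → ZMod 3) ≃ₗ[ℤ] (X → ZMod 3) :=
  LinearEquiv.ofInvolutive
    { toFun := fun f v => if χ v = 0 then f v else - f v
      map_add' := fun f g => by
        ext v
        by_cases h : χ v = 0 <;> simp [h, add_comm]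
      map_smul' := fun c f => by
        ext v
        by_cases h : χ v = 0 <;> simp [h] }
    (fun f => by
      ext v
      by_cases h : χ v = 0 <;> simp [h])

theorem signMul_apply {X : Type} (χ : X → ZMod 2) (f : X → ZMod 3) (v : X) :
    signMul χ f v = if χ v = 0 then f v else - f v := rfl

variable {V : Type} [AddCommGroup V]

/-- Translation by `v` of one of the two coordinates. -/
def translate (b : Bool) (v : V) : Equiv.Perm (V × V) :=
  Equiv.addRight (if b then (0, v) else (v, 0))

/-- Action on one of the two coordinates. -/
def onCoord (b : Bool) (e : V ≃+ V) : Equiv.Perm (V × V) :=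
  if b then (Equiv.refl V).prodCongr e.toEquiv else e.toEquiv.prodCongr (Equiv.refl V)

variable (V) in
/-- The shear `(v, w) ↦ (v, w + v)`. -/
def shear : Equiv.Perm (V × V) where
  toFun p := (p.1, p.2 + p.1)
  invFun p := (p.1, p.2 - p.1)
  left_inv p := by simp
  right_inv p := by simp

variable {Q K Γ : Type}

/-- The action of the generators determined by operators `e` and vectors `s`. -/
def modelGen {A : Type} (e : A → V ≃+ V) (s : Q → V) (χ : V → ZMod 2) :
    Gen Q A → ((V × V → ZMod 3) ≃ₗ[ℤ] (V × V → ZMod 3))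
  | T b q => permRep _ (translate b (s q))
  | G b a i => permRep _ (if i then (onCoord b (e a))⁻¹ else onCoord b (e a))
  | D i => permRep _ (if i then (shear V)⁻¹ else shear V)
  | M => signMul fun v => χ v.2
  | E => LinearEquiv.neg ℤ

/-- Iterated application of operators. -/
def shiftList {A : Type} (x : A → V →+ V) (v : V) (ls : List A) : V :=
  ls.foldl (fun v a => x a v) v

variable {δ : Trans Q K Γ} {acc : Q} {x : Letter Q K Γ → V →+ V} {e : Letter Q K Γ → V ≃+ V}
  {s : Q → V} {χ : V → ZMod 2}

theorem dblList_modelGen (h2 : ∀ v : V, v + v = 0) (he : ∀ a v, (e a).symm v = v + x a v) (v : V)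
    (ls : List (Letter Q K Γ)) :
    dblList (modelGen e s χ) (permRep _ (translate true v)) ls =
      permRep _ (translate true (shiftList x v ls)) := by
  induction ls generalizing v with
  | nil => rfl
  | cons a ls ih =>
    change dblList _ (dbl (permRep _ (onCoord true (e a))) (permRep _ (translate true v))) ls =
      permRep _ (translate true (shiftList x (x a v) ls))
    rw [← ih, dbl, ← map_inv, ← map_mul, ← map_mul, ← map_mul]
    congr 2
    ext p
    · simp [translate, onCoord, Equiv.Perm.inv_def]
    · simp only [translate, onCoord, Equiv.Perm.inv_def]
      have hp := he a (e a p.2)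
      rw [AddEquiv.symm_apply_apply] at hp
      simp only [he, Equiv.Perm.coe_mul, comp_apply, Equiv.coe_addRight, if_true, Equiv.prodCongr_apply,
        Equiv.prodCongr_symm, Prod.map, AddEquiv.toEquiv_eq_coe, EquivLike.coe_coe, Prod.snd_add,
        AddEquiv.coe_toEquiv_symm, map_add]
      calc _ = e a p.2 + x a (e a p.2) + x a v + (v + v) := by abel
        _ = _ := by rw [← hp, h2, add_zero]

theorem modelGen_models (h2 : ∀ v : V, v + v = 0) (he : ∀ a v, (e a).symm v = v + x a v)
    (hcomm : ∀ a b : Letter Q K Γ, a.1 ≠ b.1 → ∀ v, x a (x b v) = x b (x a v))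
    (hrule : ∀ q k f o, δ q = some (k, f) →
      x (some k, Sum.inl o) (s q) = shiftList x (s (f o).1) (ruleLetters q k o (f o).2))
    (hacc : s acc = 0) : Models δ acc (modelGen e s χ) := by
  have hinv : ∀ a, modelGen e s χ (G true a true) = (modelGen e s χ (G true a false))⁻¹ := by
    intro a
    simp [modelGen]
  intro p hp
  cases hp with
  | inv_G b a i => cases i <;> simp [wordEval, modelGen]
  | inv_D i => cases i <;> simp [wordEval, modelGen]
  | comm y z =>
    rcases y with q | a <;> rcases z with q' | a' <;>
    · simp only [wordEval, modelGen, copy, List.map_cons, List.map_nil, List.prod_cons,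
        List.prod_nil, mul_one, ← map_mul]
      refine congrArg (permRep _) ?_
      ext p <;> simp [translate, onCoord]
  | d_T1 q =>
    simp only [wordEval, modelGen, List.map_cons, List.map_nil, List.prod_cons,
      List.prod_nil, mul_one, ← map_mul]
    congr 1
    ext p <;> simp [translate, shear, add_assoc]
  | d_T2 q =>
    simp only [wordEval, modelGen, List.map_cons, List.map_nil, List.prod_cons,
      List.prod_nil, mul_one, ← map_mul]
    congr 1
    ext p <;> simp [translate, shear, add_right_comm]
  | d_G a =>
    simp only [wordEval, modelGen, List.map_cons, List.map_nil, List.prod_cons,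
      List.prod_nil, mul_one, ← map_mul]
    congr 1
    ext p <;> simp [onCoord, shear]
  | comm_G a b h =>
    simp only [wordEval, modelGen, List.map_cons, List.map_nil, List.prod_cons,
      List.prod_nil, mul_one, ← map_mul]
    congr 1
    have key : ∀ v, e a (e b v) = e b (e a v) := by
      intro v
      apply (e a).symm.injective
      apply (e b).symm.injective
      have : ∀ v, (e b).symm ((e a).symm v) = (e a).symm ((e b).symm v) := by
        intro v
        simp only [he, map_add, hcomm a b h]
        abel
      rw [(e a).symm_apply_apply, (e b).symm_apply_apply, this, (e b).symm_apply_apply,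
        (e a).symm_apply_apply]
    ext p <;> simp [onCoord, key]
  | rule p =>
    obtain ⟨q, o⟩ := p
    unfold ruleWords
    dsimp only
    split
    · rfl
    · rename_i k f hδ
      have hT : ∀ q, wordEval (modelGen e s χ) [T true q] = permRep _ (translate true (s q)) := by
        intro q
        simp [wordEval, modelGen]
      rw [wordEval_commWord hinv, wordEval_commWord hinv, hT, hT, dblList_modelGen h2 he,
        dblList_modelGen h2 he, ← hrule q k f o hδ]
      rfl
  | accept =>
    have : translate true (0 : V) = 1 := by ext p <;> simp [translate]
    simp [wordEval, modelGen, hacc, this]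

theorem wordEval_modelGen_start (h2 : ∀ v : V, v + v = 0) (he : ∀ a v, (e a).symm v = v + x a v)
    (φ : V →+ ZMod 2) (q : Q) (ls : List (Letter Q K Γ)) (h : φ (shiftList x (s q) ls) = 1) :
    wordEval (modelGen e s φ) (commWord [T true q] ls ++ [M]) =
      wordEval (modelGen e s φ) (M :: (commWord [T true q] ls ++ [E])) := by
  have hinv : ∀ a, modelGen e s φ (G true a true) = (modelGen e s φ (G true a false))⁻¹ := by
    intro a
    simp [modelGen]
  have hcons : ∀ w, wordEval (modelGen e s φ) (M :: w) =
      modelGen e s φ M * wordEval (modelGen e s φ) w := fun w => by simp [wordEval]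
  rw [hcons, wordEval_append, wordEval_append, wordEval_commWord hinv]
  have hT : wordEval (modelGen e s φ) [T true q] = permRep _ (translate true (s q)) := by
    simp [wordEval, modelGen]
  rw [hT, dblList_modelGen h2 he]
  ext f v
  simp only [wordEval, List.map_cons, List.map_nil, List.prod_cons, List.prod_nil, mul_one,
    LinearEquiv.mul_apply, modelGen, permRep_apply, signMul_apply, translate, Equiv.Perm.inv_def]
  have hz : ∀ z : ZMod 2, ¬ z = 0 → z + 1 = 0 := by decide
  by_cases hv : φ v.2 = 0
  · simp [h, hv]
  · simp [h, hv, hz]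

end Shift

/-! ### Machine runs with a history -/

section History

variable {Q K Γ : Type} [DecidableEq K]

variable (Q K Γ) in
/-- The contents of all stacks, including the history. -/
abbrev Stacks := Option K → List (Option Γ ⊕ Q × Option Γ)

/-- Push a list of letters, its head ending up on top. -/
def pushLetters (ls : List (Letter Q K Γ)) (w : Stacks Q K Γ) : Stacks Q K Γ :=
  fun j => proj j ls ++ w j

theorem pushLetters_append (ls ls' : List (Letter Q K Γ)) (w : Stacks Q K Γ) :
    pushLetters (ls ++ ls') w = pushLetters ls (pushLetters ls' w) := by
  ext1 j
  simp [pushLetters]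

theorem pushLetters_injective (ls : List (Letter Q K Γ)) : Injective (pushLetters ls) := by
  intro w w' h
  ext1 j
  exact List.append_cancel_left (congrFun h j)

theorem proj_none_ruleLetters (q : Q) (k : K) (o : Option Γ) (l : List Γ) :
    proj none (ruleLetters q k o l) = [Sum.inr (q, o)] := by
  have h : ∀ l : List Γ, proj none
      (l.map (fun x => ((some k, Sum.inl (some x)) : Letter Q K Γ))) = [] := by
    intro l
    induction l with
    | nil => simp
    | cons a l ih => rw [List.map_cons, proj_cons, ih]; simp
  simp only [ruleLetters, proj_append, h]
  cases o <;> simp [proj_cons]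

/-- One step of a machine recording its history. -/
def histStep (δ : Trans Q K Γ) (c : Q × Stacks Q K Γ) : Option (Q × Stacks Q K Γ) :=
  (δ c.1).bind fun p =>
    match c.2 (some p.1) with
    | Sum.inl o :: r => some ((p.2 o).1,
        pushLetters (ruleLetters c.1 p.1 o (p.2 o).2) (update c.2 (some p.1) r))
    | _ => none

theorem pushLetters_singleton_update {j : Option K} {x} {r} {w : Stacks Q K Γ} (h : w j = x :: r) :
    pushLetters [(j, x)] (update w j r) = w := by
  ext1 j'
  by_cases hj : j = j'
  · subst hj
    simp [pushLetters, proj_cons, h]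
  · simp [pushLetters, proj_cons, hj, update_of_ne (Ne.symm hj)]

theorem histStep_push (δ : Trans Q K Γ) {q : Q} {k f} (hδ : δ q = some (k, f)) (o : Option Γ)
    (w : Stacks Q K Γ) : histStep δ (q, pushLetters [(some k, Sum.inl o)] w) =
      some ((f o).1, pushLetters (ruleLetters q k o (f o).2) w) := by
  have h1 : pushLetters [(some k, Sum.inl o)] w (some k) = Sum.inl o :: w (some k) := by
    simp [pushLetters, proj_cons]
  have h2 : update (pushLetters [(some k, Sum.inl o)] w) (some k) (w (some k)) = w :=
    pushLetters_injective [(some k, Sum.inl o)] (pushLetters_singleton_update h1)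
  simp [histStep, hδ, h1, h2]

theorem exists_of_histStep {δ : Trans Q K Γ} {c c' : Q × Stacks Q K Γ}
    (h : histStep δ c = some c') : ∃ k f o w, δ c.1 = some (k, f) ∧
      c = (c.1, pushLetters [(some k, Sum.inl o)] w) ∧
      c' = ((f o).1, pushLetters (ruleLetters c.1 k o (f o).2) w) := by
  obtain ⟨⟨k, f⟩, hδ, h⟩ := Option.bind_eq_some_iff.1 h
  dsimp only at h
  split at h
  · rename_i o r hr
    exact ⟨k, f, o, _, hδ, Prod.ext rfl (pushLetters_singleton_update hr).symm,
      (Option.some.inj h).symm⟩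
  · cases h

/-- A configuration with history represents a machine configuration. -/
def HistRep (c : Q × (K → List Γ)) (c' : Q × Stacks Q K Γ) : Prop :=
  c.1 = c'.1 ∧ ∀ k, c'.2 (some k) = encStack (c.2 k)

theorem respects_histStep (δ : Trans Q K Γ) :
    StateTransition.Respects (stepCfg δ) (histStep δ) HistRep := by
  rintro ⟨q, S⟩ ⟨_, w⟩ ⟨rfl, hw⟩
  dsimp only at hw
  cases hδ : δ q with
  | none => simp [stepCfg, histStep, hδ]
  | some p =>
    obtain ⟨k, f⟩ := p
    set o := (S k).head? with ho
    have hr : ∃ r, w (some k) = Sum.inl o :: r ∧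
        o.elim [Sum.inl none] (fun _ => []) ++ r = encStack (S k).tail := by
      rw [hw k, ho]
      cases S k with
      | nil => exact ⟨[], rfl, rfl⟩
      | cons a l => exact ⟨encStack l, rfl, rfl⟩
    obtain ⟨r, hr, hr'⟩ := hr
    simp only [stepCfg, hδ, Option.map_some]
    refine ⟨((f o).1, pushLetters (ruleLetters q k o (f o).2) (update w (some k) r)),
      ⟨rfl, fun k' => ?_⟩, Relation.TransGen.single ?_⟩
    · dsimp only
      by_cases hk : k = k'
      · subst hk
        simp only [pushLetters, proj_ruleLetters, if_pos, update_self, List.append_assoc, hr']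
        simp [encStack, ho]
      · have hk' : some k' ≠ some k := by simpa using Ne.symm hk
        simp [pushLetters, proj_ruleLetters, hk, update_of_ne hk', update_of_ne (Ne.symm hk), hw]
    · simp [histStep, hδ, hr]

theorem reaches_push_iff {δ : Trans Q K Γ} {c₀ : Q × Stacks Q K Γ} (h₀ : c₀.2 none = [])
    {q : Q} {k f} (hδ : δ q = some (k, f)) (o : Option Γ) (w : Stacks Q K Γ) :
    StateTransition.Reaches (histStep δ) c₀ (q, pushLetters [(some k, Sum.inl o)] w) ↔
      StateTransition.Reaches (histStep δ) c₀
        ((f o).1, pushLetters (ruleLetters q k o (f o).2) w) := by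
  constructor
  · exact fun h => h.tail (histStep_push δ hδ o w)
  · intro h
    rcases Relation.ReflTransGen.cases_tail h with h | ⟨c, hc, h⟩
    · rw [← h] at h₀
      simp [pushLetters, proj_none_ruleLetters] at h₀
    · obtain ⟨k', f', o', w', hδ', hc', h'⟩ := exists_of_histStep h
      obtain ⟨h1, h2⟩ := Prod.mk.inj h'
      have h3 := congrFun h2 none
      simp only [pushLetters, proj_none_ruleLetters, List.cons_append, List.nil_append,
        List.cons.injEq, Sum.inr.injEq, Prod.mk.injEq] at h3
      obtain ⟨⟨hq, rfl⟩, -⟩ := h3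
      rw [← hq, hδ] at hδ'
      obtain ⟨rfl, rfl⟩ := Prod.mk.inj (Option.some.inj hδ')
      rw [← hq] at h2
      rw [pushLetters_injective _ h2, hq]
      rwa [← hc']

end History

theorem finite_reaches {σ : Type*} {f : σ → Option σ} {a b : σ}
    (h : b ∈ StateTransition.eval f a) : {c | StateTransition.Reaches f a c}.Finite := by
  obtain ⟨h1, h2⟩ := StateTransition.mem_eval.1 h
  clear h
  have hsucc : ∀ a, {c | StateTransition.Reaches f a c} ⊆
      {a} ∪ {c | ∃ a' ∈ f a, StateTransition.Reaches f a' c} := by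
    intro a c hc
    rcases Relation.ReflTransGen.cases_head hc with h | ⟨a', h, h'⟩
    · exact Or.inl h.symm
    · exact Or.inr ⟨a', h, h'⟩
  induction h1 using Relation.ReflTransGen.head_induction_on with
  | refl =>
    refine (Set.finite_singleton b).subset ((hsucc b).trans ?_)
    simp [h2]
  | @head a a' ha _ ih =>
    refine ((Set.finite_singleton a).union ih).subset ((hsucc a).trans ?_)
    refine Set.union_subset_union_right _ ?_
    rintro c ⟨a'', h, h'⟩
    obtain rfl : a' = a'' := Option.mem_unique ha h
    exact h'

section ShiftOp

variable {Q K Γ : Type}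

variable (Q K Γ) in
/-- Stack contents of height at most `N`. -/
def boundedStacks (N : ℕ) : Set (Stacks Q K Γ) := {w | ∀ j, (w j).length ≤ N}

theorem finite_boundedStacks [Finite Q] [Finite K] [Finite Γ] (N : ℕ) :
    (boundedStacks Q K Γ N).Finite := by
  have : boundedStacks Q K Γ N =
      Set.pi Set.univ fun _ => {l : List (Option Γ ⊕ Q × Option Γ) | l.length ≤ N} := by
    ext w; simp [boundedStacks]
  rw [this]
  exact Set.Finite.pi fun _ => List.finite_length_le _ _

theorem exists_extension {N : ℕ} (v : boundedStacks Q K Γ N → ZMod 2) :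
    ∃ g : Stacks Q K Γ → ZMod 2, (∀ w ∉ boundedStacks Q K Γ N, g w = 0) ∧ v = fun w => g w.1 := by
  classical
  exact ⟨fun w => if h : w ∈ boundedStacks Q K Γ N then v ⟨w, h⟩ else 0,
    fun w hw => dif_neg hw, by ext w; simp⟩

variable [DecidableEq K]

theorem mem_boundedStacks_of_push {N : ℕ} {ls : List (Letter Q K Γ)} {w : Stacks Q K Γ}
    (h : pushLetters ls w ∈ boundedStacks Q K Γ N) : w ∈ boundedStacks Q K Γ N := by
  intro j
  have := h j
  simp only [pushLetters, List.length_append] at this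
  omega

/-- The operator precomposing a function on stack contents with pushing a letter. -/
noncomputable def shiftOp (N : ℕ) (a : Letter Q K Γ) :
    (boundedStacks Q K Γ N → ZMod 2) →+ (boundedStacks Q K Γ N → ZMod 2) :=
  open Classical in
  { toFun := fun g w => if h : pushLetters [a] w.1 ∈ boundedStacks Q K Γ N then g ⟨_, h⟩ else 0
    map_zero' := by ext w; simp
    map_add' := fun g h => by
      ext w
      by_cases hw : pushLetters [a] w.1 ∈ boundedStacks Q K Γ N <;> simp [hw] }

theorem shiftOp_apply_of_mem {N : ℕ} {a : Letter Q K Γ} (g : boundedStacks Q K Γ N → ZMod 2) {w}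
    (h : pushLetters [a] w.1 ∈ boundedStacks Q K Γ N) : shiftOp N a g w = g ⟨_, h⟩ :=
  dif_pos h

theorem shiftOp_apply_of_notMem {N : ℕ} {a : Letter Q K Γ} (g : boundedStacks Q K Γ N → ZMod 2) {w}
    (h : pushLetters [a] w.1 ∉ boundedStacks Q K Γ N) : shiftOp N a g w = 0 :=
  dif_neg h

theorem shiftList_shiftOp {N : ℕ} {g : Stacks Q K Γ → ZMod 2}
    (hg : ∀ w ∉ boundedStacks Q K Γ N, g w = 0) (ls : List (Letter Q K Γ)) :
    shiftList (shiftOp N) (fun w => g w.1) ls = fun w => g (pushLetters ls w.1) := by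
  induction ls generalizing g with
  | nil => rfl
  | cons a ls ih =>
    have h : shiftOp N a (fun w => g w.1) = fun w => g (pushLetters [a] w.1) := by
      ext w
      by_cases hw : pushLetters [a] w.1 ∈ boundedStacks Q K Γ N
      · rw [shiftOp_apply_of_mem _ hw]
      · rw [shiftOp_apply_of_notMem _ hw, hg _ hw]
    change shiftList (shiftOp N) (shiftOp N a _) ls = _
    rw [h, ih (g := fun w => g (pushLetters [a] w))
      fun w hw => hg _ fun h' => hw (mem_boundedStacks_of_push h')]
    ext w
    rw [← pushLetters_append]
    rfl

theorem shiftOp_comm (N : ℕ) {a b : Letter Q K Γ} (hab : a.1 ≠ b.1) (v) :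
    shiftOp N a (shiftOp N b v) = shiftOp N b (shiftOp N a v) := by
  obtain ⟨g, hg, rfl⟩ := exists_extension v
  have h1 := shiftList_shiftOp hg [b, a]
  have h2 := shiftList_shiftOp hg [a, b]
  refine h1.trans (Eq.trans ?_ h2.symm)
  ext w
  congr 1
  ext1 j
  by_cases ha : a.1 = j
  · subst ha
    simp [pushLetters, proj_cons, hab.symm]
  · simp [pushLetters, proj_cons, ha]

theorem id_add_shiftOp_injective (N : ℕ) (a : Letter Q K Γ) :
    Injective (AddMonoidHom.id (boundedStacks Q K Γ N → ZMod 2) + shiftOp N a) := by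
  rw [injective_iff_map_eq_zero]
  intro g hg
  have h : ∀ n, ∀ w : boundedStacks Q K Γ N, N < (w.1 a.1).length + n → g w = 0 := by
    intro n
    induction n with
    | zero => intro w hw; exact absurd (w.2 a.1) (by omega)
    | succ n ih =>
      intro w hw
      have h0 := congrFun hg w
      simp only [AddMonoidHom.add_apply, AddMonoidHom.id_apply, Pi.add_apply, Pi.zero_apply] at h0
      by_cases hm : pushLetters [a] w.1 ∈ boundedStacks Q K Γ N
      · rw [shiftOp_apply_of_mem _ hm, ih ⟨_, hm⟩ (by simp [pushLetters, proj_cons]; omega),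
          add_zero] at h0
        exact h0
      · rwa [shiftOp_apply_of_notMem _ hm, add_zero] at h0
  ext w
  exact h (N + 1) w (by omega)

/-- The automorphism inverse to `1 + shiftOp N a`. -/
noncomputable def shiftEquiv [Finite Q] [Finite K] [Finite Γ] (N : ℕ) (a : Letter Q K Γ) :
    (boundedStacks Q K Γ N → ZMod 2) ≃+ (boundedStacks Q K Γ N → ZMod 2) :=
  haveI : Finite (boundedStacks Q K Γ N) := finite_boundedStacks N
  (AddEquiv.ofBijective (AddMonoidHom.id _ + shiftOp N a)
    (Finite.injective_iff_bijective.1 (id_add_shiftOp_injective N a))).symm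

theorem shiftEquiv_symm_apply [Finite Q] [Finite K] [Finite Γ] (N : ℕ) (a : Letter Q K Γ) (v) :
    (shiftEquiv N a).symm v = v + shiftOp N a v := rfl

/-- A computation halting outside of the accepting state yields a finite linear model of the
relations attached to a machine, in which `E` acts as `-1`. -/
theorem exists_model [Finite Q] [Finite K] [Finite Γ] {δ : Trans Q K Γ} {acc q₀ : Q}
    {S₀ : K → List Γ} {c : Q × (K → List Γ)} (hacc : δ acc = none)
    (hc : c ∈ StateTransition.eval (stepCfg δ) (q₀, S₀)) (hca : c.1 ≠ acc)
    {ls : List (Letter Q K Γ)} (hls : Represents ls S₀) (hls₀ : proj none ls = []) :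
    ∃ (X : Type) (γ : Gen Q (Letter Q K Γ) → ((X → ZMod 3) ≃ₗ[ℤ] (X → ZMod 3))),
      Finite X ∧ Nonempty X ∧ Models δ acc γ ∧
      wordEval γ (commWord [T true q₀] ls ++ [M]) =
        wordEval γ (M :: (commWord [T true q₀] ls ++ [E])) ∧ ∀ f, γ E f = - f := by
  classical
  let c₀ : Q × Stacks Q K Γ := (q₀, pushLetters ls fun _ => [])
  have hrep : HistRep (q₀, S₀) c₀ := ⟨rfl, fun k => by simpa [c₀, pushLetters] using hls k⟩
  have h₀ : c₀.2 none = [] := by simpa [c₀, pushLetters] using hls₀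
  obtain ⟨c', hcc', hc'⟩ := StateTransition.tr_eval (respects_histStep δ) hrep hc
  have hfin := finite_reaches hc'
  obtain ⟨N, hN⟩ : ∃ N, ∀ d, StateTransition.Reaches (histStep δ) c₀ d →
      d.2 ∈ boundedStacks Q K Γ N := by
    have hfin2 : (⋃ d ∈ {d | StateTransition.Reaches (histStep δ) c₀ d},
        Set.range fun j => (d.2 j).length).Finite :=
      hfin.biUnion fun d _ => Set.finite_range _
    obtain ⟨N, hN⟩ := hfin2.bddAbove
    exact ⟨N, fun d hd j => hN (Set.mem_biUnion (show d ∈ {d | _} from hd) ⟨j, rfl⟩)⟩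
  let ind : Q → Stacks Q K Γ → ZMod 2 := fun q w =>
    if StateTransition.Reaches (histStep δ) c₀ (q, w) then 1 else 0
  have hind : ∀ q, ∀ w ∉ boundedStacks Q K Γ N, ind q w = 0 := fun q w hw =>
    if_neg fun h => hw (hN _ h)
  let s : Q → boundedStacks Q K Γ N → ZMod 2 := fun q w => ind q w.1
  have hs : s acc = 0 := by
    ext w
    refine if_neg fun h => hca ?_
    have h1 : histStep δ (acc, w.1) = none := by simp [histStep, hacc]
    have h2 := Part.mem_unique hc' (StateTransition.mem_eval.2 ⟨h, h1⟩)
    rw [hcc'.1, h2]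
  have h2 : ∀ v : boundedStacks Q K Γ N → ZMod 2, v + v = 0 := fun v => by
    ext w; exact CharTwo.add_self_eq_zero _
  let φ : (boundedStacks Q K Γ N → ZMod 2) →+ ZMod 2 :=
    Pi.evalAddMonoidHom _ ⟨fun _ => [], fun _ => Nat.zero_le _⟩
  have hφ : φ (shiftList (shiftOp N) (s q₀) ls) = 1 := by
    simp only [s, shiftList_shiftOp (hind q₀)]
    exact if_pos Relation.ReflTransGen.refl
  have hfinN : Finite (boundedStacks Q K Γ N) := finite_boundedStacks N
  refine ⟨_, modelGen (shiftEquiv N) s φ, inferInstance, inferInstance,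
    modelGen_models (x := shiftOp N) h2 (shiftEquiv_symm_apply N) (fun a b h => shiftOp_comm N h)
      (fun q k f o hδ => ?_) hs,
    wordEval_modelGen_start (x := shiftOp N) h2 (shiftEquiv_symm_apply N) φ q₀ ls hφ, fun f => rfl⟩
  have h1 := shiftList_shiftOp (hind q) [(some k, Sum.inl o)]
  refine h1.trans (Eq.trans ?_ (shiftList_shiftOp (hind (f o).1) _).symm)
  ext w
  simp only [ind, reaches_push_iff h₀ hδ]

end ShiftOp
/-! ### Partial recursive functions on stack machines -/

section TM2

open Turing

variable {K Γ Λ σ : Type}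

/-- A stack machine executing a `TM2` program one statement at a time. When the program halts, the
top of the stack `k₀` is tested. -/
def stmtTrans (M : Λ → TM2.Stmt (fun _ : K => Γ) Λ σ) (k₀ : K) (test : Option Γ → Bool) :
    Trans (TM2.Stmt (fun _ : K => Γ) Λ σ × σ ⊕ Bool) K Γ
  | .inl (.push k f q, v) => some (k, fun o => (.inl (q, v), f v :: o.toList))
  | .inl (.peek k f q, v) => some (k, fun o => (.inl (q, f v o), o.toList))
  | .inl (.pop k f q, v) => some (k, fun o => (.inl (q, f v o), []))
  | .inl (.load a q, v) => some (k₀, fun o => (.inl (q, a v), o.toList))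
  | .inl (.branch f q₁ q₂, v) => some (k₀, fun o => (.inl (cond (f v) q₁ q₂, v), o.toList))
  | .inl (.goto l, v) => some (k₀, fun o => (.inl (M (l v), v), o.toList))
  | .inl (.halt, _) => some (k₀, fun o => (.inr (test o), o.toList))
  | .inr _ => none

/-- The configuration of `stmtTrans` corresponding to a configuration of a `TM2` program. -/
def stmtCfg (M : Λ → TM2.Stmt (fun _ : K => Γ) Λ σ) (k₀ : K) (test : Option Γ → Bool) :
    TM2.Cfg (fun _ : K => Γ) Λ σ → (TM2.Stmt (fun _ : K => Γ) Λ σ × σ ⊕ Bool) × (K → List Γ)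
  | ⟨some l, v, S⟩ => (.inl (M l, v), S)
  | ⟨none, _, S⟩ => (.inr (test (S k₀).head?), S)

theorem head?_toList_append_tail (l : List Γ) : l.head?.toList ++ l.tail = l := by
  cases l <;> rfl

/-- The states of `stmtTrans` reachable from a set of labels. -/
def stmtStates (M : Λ → TM2.Stmt (fun _ : K => Γ) Λ σ) (s : Finset Λ) :
    Set (TM2.Stmt (fun _ : K => Γ) Λ σ × σ ⊕ Bool) :=
  {q | ∀ p, q = .inl p → some p.1 ∈ TM2.stmts M s}

theorem finite_stmtStates [Finite σ] (M : Λ → TM2.Stmt (fun _ : K => Γ) Λ σ) (s : Finset Λ) :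
    (stmtStates M s).Finite := by
  have h : {q | some q ∈ TM2.stmts M s}.Finite :=
    (TM2.stmts M s).finite_toSet.preimage (Option.some_injective _).injOn
  refine (((h.prod (Set.finite_univ (α := σ))).image Sum.inl).union
    (Set.finite_range (Sum.inr : Bool → _))).subset ?_
  rintro (p | b) hq
  · exact .inl ⟨p, ⟨hq p rfl, trivial⟩, rfl⟩
  · exact .inr ⟨b, rfl⟩

theorem some_mem_stmts {M : Λ → TM2.Stmt (fun _ : K => Γ) Λ σ} {s : Finset Λ}
    {q : TM2.Stmt (fun _ : K => Γ) Λ σ} :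
    some q ∈ TM2.stmts M s ↔ ∃ l ∈ s, q ∈ TM2.stmts₁ (M l) := by
  simp [TM2.stmts]

theorem stmtTrans_mem_stmtStates {M : Λ → TM2.Stmt (fun _ : K => Γ) Λ σ} {k₀ : K}
    {test : Option Γ → Bool} {s : Finset Λ}
    (hs : ∀ l ∈ s, TM2.SupportsStmt s (M l)) :
    ∀ q ∈ stmtStates M s, ∀ k f, stmtTrans M k₀ test q = some (k, f) →
      ∀ o, (f o).1 ∈ stmtStates M s := by
  rintro (⟨q, v⟩ | b) hq k f hf o p hp
  · have hq := hq _ rfl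
    have hsub : ∀ q' ∈ TM2.stmts₁ q, some q' ∈ TM2.stmts M s :=
      fun q' h => TM2.stmts_trans h hq
    obtain ⟨l, hl, hql⟩ := some_mem_stmts.1 hq
    have hsup := TM2.stmts₁_supportsStmt_mono hql (hs l hl)
    cases q with
    | goto g =>
      simp only [stmtTrans, Option.some.injEq, Prod.mk.injEq] at hf
      obtain ⟨rfl, rfl⟩ := hf
      simp only [Sum.inl.injEq] at hp
      subst hp
      exact some_mem_stmts.2 ⟨g v, hsup v, TM2.stmts₁_self⟩
    | halt =>
      simp only [stmtTrans, Option.some.injEq, Prod.mk.injEq] at hf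
      obtain ⟨rfl, rfl⟩ := hf
      simp at hp
    | branch c q₁ q₂ =>
      simp only [stmtTrans, Option.some.injEq, Prod.mk.injEq] at hf
      obtain ⟨rfl, rfl⟩ := hf
      simp only [Sum.inl.injEq] at hp
      subst hp
      refine hsub _ ?_
      cases c v <;> simp [TM2.stmts₁, TM2.stmts₁_self]
    | _ =>
      simp only [stmtTrans, Option.some.injEq, Prod.mk.injEq] at hf
      obtain ⟨rfl, rfl⟩ := hf
      simp only [Sum.inl.injEq] at hp
      subst hp
      refine hsub _ ?_
      simp [TM2.stmts₁, TM2.stmts₁_self]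
  · simp [stmtTrans] at hf

variable [DecidableEq K]

theorem reaches₁_stepAux (M : Λ → TM2.Stmt (fun _ : K => Γ) Λ σ) (k₀ : K) (test : Option Γ → Bool)
    (q : TM2.Stmt (fun _ : K => Γ) Λ σ) (v : σ) (S : K → List Γ) :
    StateTransition.Reaches₁ (stepCfg (stmtTrans M k₀ test)) (.inl (q, v), S)
      (stmtCfg M k₀ test (TM2.stepAux q v S)) := by
  induction q generalizing v S with
  | push k f q ih =>
    refine Relation.TransGen.head ?_ (ih _ _)
    simp [stepCfg, stmtTrans, head?_toList_append_tail]
  | peek k f q ih =>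
    refine Relation.TransGen.head ?_ (ih _ _)
    simp [stepCfg, stmtTrans, head?_toList_append_tail]
  | pop k f q ih =>
    refine Relation.TransGen.head ?_ (ih _ _)
    simp [stepCfg, stmtTrans]
  | load a q ih =>
    refine Relation.TransGen.head ?_ (ih _ _)
    simp [stepCfg, stmtTrans, head?_toList_append_tail]
  | branch f q₁ q₂ ih₁ ih₂ =>
    rw [TM2.stepAux]
    cases hf : f v
    · refine Relation.TransGen.head ?_ (ih₂ _ _)
      simp [stepCfg, stmtTrans, head?_toList_append_tail, hf]
    · refine Relation.TransGen.head ?_ (ih₁ _ _)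
      simp [stepCfg, stmtTrans, head?_toList_append_tail, hf]
  | goto l =>
    refine Relation.TransGen.single ?_
    simp [stepCfg, stmtTrans, stmtCfg, head?_toList_append_tail]
  | halt =>
    refine Relation.TransGen.single ?_
    simp [stepCfg, stmtTrans, stmtCfg, head?_toList_append_tail]

theorem respects_stmtTrans (M : Λ → TM2.Stmt (fun _ : K => Γ) Λ σ) (k₀ : K)
    (test : Option Γ → Bool) :
    StateTransition.Respects (TM2.step M) (stepCfg (stmtTrans M k₀ test))
      fun a b => stmtCfg M k₀ test a = b := by
  rw [StateTransition.fun_respects]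
  rintro ⟨_ | l, v, S⟩
  · rfl
  · exact reaches₁_stepAux M k₀ test (M l) v S

end TM2

section Restrict

variable {Q K Γ : Type}

open Classical in
/-- The restriction of a transition function to a set of states. -/
noncomputable def Trans.restrict (δ : Trans Q K Γ) (s : Set Q) : Trans s K Γ := fun q =>
  (δ q).map fun p => (p.1, fun o => (if h : (p.2 o).1 ∈ s then ⟨_, h⟩ else q, (p.2 o).2))

theorem respects_restrict [DecidableEq K] {δ : Trans Q K Γ} {s : Set Q}
    (hs : ∀ q ∈ s, ∀ k f, δ q = some (k, f) → ∀ o, (f o).1 ∈ s) :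
    StateTransition.Respects (stepCfg δ) (stepCfg (δ.restrict s))
      fun a b => a = (b.1.1, b.2) := by
  rintro _ ⟨q, S⟩ rfl
  cases h : δ q.1 with
  | none => simp [stepCfg, Trans.restrict, h]
  | some p =>
    obtain ⟨k, f⟩ := p
    have hf := hs q.1 q.2 k f h
    simp only [stepCfg, h, Option.map_some]
    refine ⟨(⟨_, hf _⟩, update S k ((f (S k).head?).2 ++ (S k).tail)), rfl, Relation.TransGen.single ?_⟩
    simp [stepCfg, Trans.restrict, h, hf]

end Restrict

section Recursive

open Turing PartrecToTM2

instance : Finite K' :=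
  Finite.of_surjective
    (fun i : Fin 4 => ![K'.main, K'.rev, K'.aux, K'.stack] i) fun k => by
      cases k
      exacts [⟨0, rfl⟩, ⟨1, rfl⟩, ⟨2, rfl⟩, ⟨3, rfl⟩]

theorem trNat_two_pow (n : ℕ) : trNat (2 ^ n) = List.replicate n Γ'.bit0 ++ [Γ'.bit1] := by
  have h : ∀ n, ((2 ^ n : ℕ) : Num) = Num.pos (PosNum.bit0^[n] PosNum.one) := by
    intro n
    induction n with
    | zero => rfl
    | succ n ih =>
      rw [pow_succ, mul_two, Nat.cast_add, ih, Num.bit0_of_bit0, iterate_succ_apply']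
      rfl
  rw [trNat, h]
  induction n with
  | zero => rfl
  | succ n ih =>
    rw [iterate_succ_apply', List.replicate_succ, List.cons_append, ← ih]
    rfl

theorem primrec_two_pow : Primrec fun n : ℕ => 2 ^ n := by
  refine (Primrec.nat_rec₁ (f := fun _ r => 2 * r) 1
    (Primrec.nat_mul.comp (Primrec.const 2) Primrec.snd)).of_eq fun n => ?_
  induction n with
  | zero => rfl
  | succ n ih => simp only [pow_succ, ← ih]; ring

/-- A partial recursive function is computed by a stack machine, on input `n` in unary. -/
theorem exists_machine {F : ℕ →. ℕ} (hF : Partrec F) :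
    ∃ (Q : Type) (_ : Finite Q) (δ : Trans Q K' Γ') (q₀ acc : Q), δ acc = none ∧
      ∀ n, ∀ b ∈ F n, ∃ c ∈ StateTransition.eval (stepCfg δ)
        (q₀, K'.elim (List.replicate n Γ'.bit0 ++ [Γ'.bit1, Γ'.cons]) [] [] []),
        (b = 1 → c.1 = acc) ∧ (b = 0 → c.1 ≠ acc) := by
  have hlog : Primrec fun m : ℕ => m.findGreatest fun k => 2 ^ k = m :=
    Primrec.nat_findGreatest Primrec.id
      (Primrec.eq.comp (primrec_two_pow.comp Primrec.snd) Primrec.fst)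
  have hF' : Partrec fun m : ℕ => F (m.findGreatest fun k => 2 ^ k = m) := hF.comp hlog.to_comp
  obtain ⟨c, hc⟩ := ToPartrec.Code.exists_code (Nat.Partrec'.part_iff₁.2 hF')
  have hc' : ∀ n, c.eval [2 ^ n] = pure <$> F n := by
    intro n
    have h := hc (2 ^ n ::ᵥ List.Vector.nil)
    have h2 : (2 ^ n).findGreatest (fun k => 2 ^ k = 2 ^ n) = n :=
      Nat.findGreatest_eq_iff.2 ⟨Nat.lt_two_pow_self.le, fun _ => rfl,
        fun k hk _ h => hk.ne' (Nat.pow_right_injective le_rfl h)⟩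
    simp only [List.Vector.head_cons, h2] at h
    exact h
  let test : Option Γ' → Bool := fun o => decide (o = some Γ'.bit1)
  let s := codeSupp c Cont'.halt
  have hs := tr_supports c Cont'.halt
  have hcl := stmtTrans_mem_stmtStates (k₀ := K'.main) (test := test) hs.2
  have hq₀ : .inl (tr (trNormal c Cont'.halt), none) ∈ stmtStates tr s := by
    rintro p hp
    simp only [Sum.inl.injEq] at hp
    subst hp
    exact some_mem_stmts.2 ⟨_, hs.1, TM2.stmts₁_self⟩
  have hb : ∀ b, .inr b ∈ stmtStates tr s := fun b p hp => by simp at hp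
  refine ⟨stmtStates tr s, finite_stmtStates tr s, (stmtTrans tr K'.main test).restrict _,
    ⟨_, hq₀⟩, ⟨_, hb true⟩, rfl, fun n b hbn => ?_⟩
  have h1 : halt [b] ∈ halt <$> c.eval [2 ^ n] := by
    rw [hc']
    exact Part.mem_map _ (Part.mem_map _ hbn)
  rw [← tr_eval] at h1
  obtain ⟨d, rfl, hd⟩ := StateTransition.tr_eval (respects_stmtTrans tr K'.main test) rfl h1
  obtain ⟨e, he, hee⟩ := StateTransition.tr_eval (respects_restrict hcl)
    (a₂ := (⟨_, hq₀⟩, K'.elim (trList [2 ^ n]) [] [] [])) rfl hd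
  refine ⟨e, ?_, ?_, ?_⟩
  · simpa [trList, trNat_two_pow] using hee
  · rintro rfl
    refine Subtype.ext ((congrArg Prod.fst he).symm.trans ?_)
    rfl
  · rintro rfl h
    have := (congrArg Prod.fst he)
    rw [h] at this
    exact Bool.false_ne_true (Sum.inr_injective this)

end Recursive
/-! ### Words as numbers -/

section WordCode

variable {G H : Type} [Group H]

/-- The number coding a word, given the numbers of the generators. -/
def wordCode (ι : G → ℕ) (w : List G) : ℕ := Encodable.encode (w.map ι)

theorem apply_encode_list {m : ℕ} {ρ : ℕ → H} (h0 : ρ 0 = 1)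
    (hcons : ∀ k < m, ρ (k + 1) = ρ (Nat.pair k.unpair.1 0 + 1) * ρ k.unpair.2) (l : List ℕ)
    (hl : Encodable.encode l ≤ m) :
    ρ (Encodable.encode l) = (l.map fun a => ρ (Nat.pair a 0 + 1)).prod := by
  induction l with
  | nil => simpa using h0
  | cons a l ih =>
    rw [Encodable.encode_list_cons, Encodable.encode_nat] at hl ⊢
    have h := hcons _ hl
    rw [Nat.unpair_pair] at h
    have hle : Encodable.encode l ≤ m := ((Nat.right_le_pair _ _).trans (Nat.le_succ _)).trans hl
    rw [Nat.succ_eq_add_one, h, ih hle, List.map_cons, List.prod_cons]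

/-- The product of the values of the letters of the word coded by a number. -/
def codeEval (γ : ℕ → H) (k : ℕ) : H := ((Denumerable.ofNat (List ℕ) k).map γ).prod

theorem codeEval_zero (γ : ℕ → H) : codeEval γ 0 = 1 := by
  simp [codeEval]

theorem codeEval_succ (γ : ℕ → H) (k : ℕ) :
    codeEval γ (k + 1) = codeEval γ (Nat.pair k.unpair.1 0 + 1) * codeEval γ k.unpair.2 := by
  simp [codeEval, Denumerable.list_ofNat_succ]

theorem codeEval_wordCode (γ : ℕ → H) (ι : G → ℕ) (w : List G) :
    codeEval γ (wordCode ι w) = (w.map fun g => γ (ι g)).prod := by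
  simp [codeEval, wordCode, comp_def]

end WordCode

theorem map_commWord {Q A : Type} (ι : Gen Q A → ℕ) (w : List (Gen Q A)) (ls : List A) :
    (commWord w ls).map ι = (ls.map fun a => (ι (G true a true), ι (G true a false))).foldl
      (fun w p => w ++ [p.1] ++ w ++ [p.2]) (w.map ι) := by
  induction ls generalizing w with
  | nil => rfl
  | cons a ls ih =>
    change (commWord _ ls).map ι = _
    rw [ih]
    simp

/-! ### Reduction to the consistency of dependencies -/

section Reduction

open Turing PartrecToTM2

/-- The input stacks on which a machine is started. -/
def inputStacks (n : ℕ) : K' → List Γ' :=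
  K'.elim (List.replicate n Γ'.bit0 ++ [Γ'.bit1, Γ'.cons]) [] [] []

variable {Q : Type}

/-- A list of letters representing the input stacks. -/
def inputLetters (n : ℕ) : List (Letter Q K' Γ') :=
  List.replicate n (some K'.main, Sum.inl (some Γ'.bit0)) ++
    [(some K'.main, Sum.inl (some Γ'.bit1)), (some K'.main, Sum.inl (some Γ'.cons)),
      (some K'.main, Sum.inl none), (some K'.rev, Sum.inl none), (some K'.aux, Sum.inl none),
      (some K'.stack, Sum.inl none)]

theorem proj_replicate (j : Option K') (n : ℕ) (a : Letter Q K' Γ') :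
    proj j (List.replicate n a) = if a.1 = j then List.replicate n a.2 else [] := by
  induction n with
  | zero => simp
  | succ n ih => rw [List.replicate_succ, proj_cons, ih]; split_ifs <;> rfl

theorem represents_inputLetters (n : ℕ) :
    Represents (inputLetters n : List (Letter Q K' Γ')) (inputStacks n) := by
  intro k
  cases k <;> simp [inputLetters, inputStacks, encStack, proj_replicate, proj_cons]

theorem proj_none_inputLetters (n : ℕ) :
    proj none (inputLetters n : List (Letter Q K' Γ')) = [] := by
  simp [inputLetters, proj_replicate, proj_cons]

/-- The word whose triviality is equivalent to acceptance of an input. -/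
def startWord (q₀ : Q) (n : ℕ) : List (Gen Q (Letter Q K' Γ')) :=
  commWord [T true q₀] (inputLetters n)

theorem primrec_wordCode_startWord (ι : Gen Q (Letter Q K' Γ') → ℕ) (q₀ : Q)
    (u v : List (Gen Q (Letter Q K' Γ'))) :
    Primrec fun n => wordCode ι (u ++ startWord q₀ n ++ v) := by
  let pr : Letter Q K' Γ' → ℕ × ℕ := fun a => (ι (G true a true), ι (G true a false))
  have hl : Primrec fun n => (inputLetters n).map pr := by
    refine (Primrec.list_append.comp (Primrec.list_map Primrec.list_range
      (Primrec.const (pr (some K'.main, Sum.inl (some Γ'.bit0)))).to₂)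
      (Primrec.const ((inputLetters 0).map pr))).of_eq fun n => ?_
    simp [inputLetters]
  have hs : Primrec fun n => (startWord q₀ n).map ι := by
    have hw : Primrec fun p : ℕ × List ℕ × ℕ × ℕ => p.2.1 := Primrec.fst.comp Primrec.snd
    have h1 : Primrec fun p : ℕ × List ℕ × ℕ × ℕ => [p.2.2.1] :=
      Primrec.list_cons.comp (Primrec.fst.comp (Primrec.snd.comp Primrec.snd)) (Primrec.const [])
    have h2 : Primrec fun p : ℕ × List ℕ × ℕ × ℕ => [p.2.2.2] :=
      Primrec.list_cons.comp (Primrec.snd.comp (Primrec.snd.comp Primrec.snd)) (Primrec.const [])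
    refine (Primrec.list_foldl hl (Primrec.const ([T true q₀].map ι))
      (h := fun _ q => q.1 ++ [q.2.1] ++ q.1 ++ [q.2.2])
      (Primrec.list_append.comp (Primrec.list_append.comp (Primrec.list_append.comp hw h1) hw)
        h2).to₂).of_eq fun n => ?_
    rw [startWord, map_commWord]
  refine (Primrec.encode.comp (Primrec.list_append.comp (Primrec.list_append.comp
    (Primrec.const (u.map ι)) hs) (Primrec.const (v.map ι)))).of_eq fun n => ?_
  simp [wordCode]

theorem zmod_three_add_self_injective : ∀ {y z : ZMod 3}, y + y = z + z → y = z := by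
  decide

/-- The halting problem of a stack machine, restricted to halting inputs, reduces to the
consistency of the dependencies of a presentation. -/
theorem exists_reduction [Finite Q] {δ : Trans Q K' Γ'} {acc : Q} (hacc : δ acc = none) (q₀ : Q) :
    ∃ (m : ℕ → ℕ) (R : ℕ → List (ℕ × ℕ)) (ε : ℕ), Primrec m ∧ Primrec R ∧ (∀ n, ε ≤ m n) ∧
      (∀ n, ∀ r ∈ R n, r.1 ≤ m n ∧ r.2 ≤ m n) ∧
      ∀ n, ∀ c ∈ StateTransition.eval (stepCfg δ) (q₀, inputStacks n),
        (∃ D : DB, D.attr = presAttr (m n) ∧ D.IsFinite ∧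
          (∀ d ∈ presDeps (m n) (R n) ε, D.SatDep d) ∧ ¬ D.AlmostTrivial) ↔ c.1 ≠ acc := by
  classical
  obtain ⟨ι, hι⟩ := Countable.exists_injective_nat (Gen Q (Letter Q K' Γ'))
  let rels := (finite_machineRel δ acc).toFinset.toList
  have hrels : ∀ p, p ∈ rels ↔ MachineRel δ acc p := fun p => by simp [rels]
  let R₀ : List (ℕ × ℕ) := rels.map fun p => (wordCode ι p.1, wordCode ι p.2)
  let u : ℕ → ℕ := fun n => wordCode ι (startWord q₀ n ++ [M])
  let v : ℕ → ℕ := fun n => wordCode ι (M :: (startWord q₀ n ++ [E]))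
  have hu : Primrec u := (primrec_wordCode_startWord ι q₀ [] [M]).of_eq fun n => rfl
  have hv : Primrec v := (primrec_wordCode_startWord ι q₀ [M] [E]).of_eq fun n => rfl
  let ε := wordCode ι [(E : Gen Q (Letter Q K' Γ'))]
  let C := ε + (R₀.map fun r => r.1 + r.2).sum
  let m : ℕ → ℕ := fun n => C + (u n + v n)
  let R : ℕ → List (ℕ × ℕ) := fun n => (u n, v n) :: R₀
  have hε : ∀ n, ε ≤ m n := fun n => by simp only [m, C]; omega
  have hR₀ : ∀ r ∈ R₀, r.1 + r.2 ≤ C := fun r hr =>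
    (List.le_sum_of_mem (List.mem_map_of_mem (f := fun r : ℕ × ℕ => r.1 + r.2) hr)).trans
      (Nat.le_add_left _ _)
  have hR : ∀ n, ∀ r ∈ R n, r.1 ≤ m n ∧ r.2 ≤ m n := by
    intro n r hr
    rcases List.mem_cons.1 hr with rfl | hr
    · simp only [m]; omega
    · have := hR₀ r hr
      simp only [m]; omega
  refine ⟨m, R, ε, Primrec.nat_add.comp (Primrec.const C) (Primrec.nat_add.comp hu hv),
    Primrec.list_cons.comp (Primrec.pair hu hv) (Primrec.const R₀), hε, hR, fun n c hc =>
    ⟨?_, fun hca => ?_⟩⟩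
  · rintro ⟨D, hD, -, hsat, htriv⟩ hca
    obtain ⟨X, ρ, h0, hcons, hrel, hone⟩ := exists_perm_of_presDeps (hε n) (hR n) hD hsat
    let γ : Gen Q (Letter Q K' Γ') → Equiv.Perm X := fun g => ρ (Nat.pair (ι g) 0 + 1)
    have hρ : ∀ w, wordCode ι w ≤ m n → ρ (wordCode ι w) = wordEval γ w := fun w hw => by
      rw [wordCode, apply_encode_list h0 hcons _ hw, List.map_map]
      rfl
    have hrel' : ∀ w w', (wordCode ι w, wordCode ι w') ∈ R n → wordEval γ w = wordEval γ w' :=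
      fun w w' h => by
        rw [← hρ w (hR n _ h).1, ← hρ w' (hR n _ h).2]
        exact hrel _ h
    have hγ : Models δ acc γ := fun p hp => hrel' _ _
      (List.mem_cons_of_mem _ (List.mem_map.2 ⟨p, (hrels p).2 hp, rfl⟩))
    have hreach : StateTransition.Reaches (stepCfg δ) (q₀, inputStacks n) (acc, c.2) := by
      rw [← hca]
      exact (StateTransition.mem_eval.1 hc).1
    have hs : wordEval γ (startWord q₀ n) = 1 := by
      rw [startWord, wordEval_commWord (eval_inv hγ)]
      simpa [wordEval] using
        dblList_eq_one_of_reaches hγ hreach (represents_inputLetters n)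
    have hME := hrel' (startWord q₀ n ++ [M]) ([M] ++ (startWord q₀ n ++ [E]))
      List.mem_cons_self
    rw [wordEval_append, wordEval_append, wordEval_append, hs,
      one_mul, one_mul, left_eq_mul] at hME
    exact htriv (hone ((hρ _ (hε n)).trans hME))
  · obtain ⟨X, γ, hX, hX', hγ, hstart, hE⟩ := exists_model hacc hc hca
      (represents_inputLetters n) (proj_none_inputLetters n)
    let ρ := codeEval (extend ι γ 1)
    have hρ : ∀ w, ρ (wordCode ι w) = wordEval γ w := fun w => by
      simp only [ρ, codeEval_wordCode, hι.extend_apply]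
      rfl
    refine exists_db_of_representation (A := X → ZMod 3) (fun a b h => ?_) (hε n) (hR n) ρ
      (codeEval_zero _) (fun k _ => codeEval_succ _ k) (fun r hr => ?_) fun a => ?_
    · ext x
      exact zmod_three_add_self_injective (congrFun h x)
    · rcases List.mem_cons.1 hr with rfl | hr
      · exact (hρ _).trans (hstart.trans (hρ _).symm)
      · obtain ⟨p, hp, rfl⟩ := List.mem_map.1 hr
        exact (hρ _).trans ((hγ p ((hrels p).1 hp)).trans (hρ _).symm)
    · rw [hρ]
      simpa [wordEval] using hE a

end Reduction

end DBConsistency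

open DBConsistency

/-- There is no algorithm which, given a finite conjunction
`Φ` of functional and embedded multivalued dependencies over a finite attribute
set `U`, decides whether some finite database with attribute set `U` satisfies
`Φ` and is not almost trivial (fails some functional dependency). -/
theorem database_consistency_undecidable :
    ¬ ∃ f : ℕ → Bool, Computable f ∧
      ∀ (U : Finset ℕ) (Φ : List Dep), U.Nonempty → (∀ d ∈ Φ, d.WF U) →
        (f (depInputCode U Φ) = true ↔
          ∃ D : DB, D.attr = U ∧ D.IsFinite ∧ (∀ d ∈ Φ, D.SatDep d) ∧
            ¬ D.AlmostTrivial) := by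
  rintro ⟨f, hf, hdec⟩
  have hF : Partrec fun n : ℕ => (Denumerable.ofNat Nat.Partrec.Code n).eval n :=
    Nat.Partrec.Code.eval_part.comp (Computable.ofNat _) Computable.id
  obtain ⟨Q, hQ, δ, q₀, acc, hacc, hrun⟩ := exists_machine hF
  obtain ⟨m, R, ε, hm, hR, hεm, hRm, hred⟩ := exists_reduction hacc q₀
  let g : ℕ → Bool := fun n => f (depInputCode (presAttr (m n)) (presDeps (m n) (R n) ε))
  have hg : Computable g :=
    hf.comp ((primrec_depInputCode ε).comp (Primrec.pair hm hR)).to_comp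
  have hb : Computable fun n => cond (g n) 1 0 :=
    Computable.cond hg (Computable.const 1) (Computable.const 0)
  obtain ⟨e, he⟩ := Nat.Partrec.Code.exists_code.1 (Partrec.nat_iff.1 hb.partrec)
  let n := Encodable.encode e
  have hn : (cond (g n) 1 0 : ℕ) ∈ (Denumerable.ofNat Nat.Partrec.Code n).eval n := by
    rw [Denumerable.ofNat_encode, he]
    exact Part.mem_some _
  obtain ⟨c, hc, h1, h0⟩ := hrun n _ hn
  have hsat : g n = true ↔ c.1 ≠ acc :=
    (hdec _ _ ⟨0, by simp [presAttr]⟩ (presDeps_wf (hεm n) (hRm n))).trans (hred n c hc)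
  cases hgn : g n with
  | true => exact hsat.1 hgn (h1 (by rw [hgn]; rfl))
  | false => exact absurd (hsat.2 (h0 (by rw [hgn]; rfl))) (by simp [hgn])
end

section
/- There is no algorithm to decide, for a given finite family p₁,…,p_k of multivariate polynomials in non-commuting variables with integer coefficients (i.e., elements of the free ℤ-algebra on finitely many generators), whether there exist a finite d ≥ 1 and matrices A₁,…,A_m ∈ ℚ^{d×d} such that p_i(A₁,…,A_m) = 0 for all i = 1,…,k. Equivalently, the set of such families admitting a common zero in some matrix ring ℚ^{d×d} with 0 < d < ℵ₀ is not decidable. -/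
/-- Multivariate polynomials in non-commuting variables with integer
coefficients, as syntactic ring terms (elements of the free ℤ-algebra on the
variables): built from variables, `0`, `1` by addition, multiplication and
negation. -/
inductive RingTerm : Type where
  | var : ℕ → RingTerm
  | zero : RingTerm
  | one : RingTerm
  | add : RingTerm → RingTerm → RingTerm
  | mul : RingTerm → RingTerm → RingTerm
  | neg : RingTerm → RingTerm

/-- Evaluation of a ring term in a ring `R` under the assignment `v` (this is
the unique ℤ-algebra homomorphism of the free algebra sending the variables to
their values). -/
def RingTerm.eval {R : Type*} [Ring R] (v : ℕ → R) : RingTerm → R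
  | .var i => v i
  | .zero => 0
  | .one => 1
  | .add p q => p.eval v + q.eval v
  | .mul p q => p.eval v * q.eval v
  | .neg p => - p.eval v

/-- An injective Gödel numbering of ring terms. -/
def RingTerm.code : RingTerm → ℕ
  | .var i => 6 * i
  | .zero => 1
  | .one => 2
  | .add p q => 6 * Nat.pair p.code q.code + 3
  | .mul p q => 6 * Nat.pair p.code q.code + 4
  | .neg p => 6 * p.code + 5

/-- A (natural) Gödel numbering of finite families of ring terms. -/
def ringFamilyCode (ps : List RingTerm) : ℕ :=
  Encodable.encode (ps.map RingTerm.code)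

/-! ### Rewriting systems on natural numbers -/

/-- An injective polynomial pairing function on the natural numbers. -/
def polyPair (a b : ℕ) : ℕ := (a + b) * (a + b) + a

theorem polyPair_inj {a b c d : ℕ} : polyPair a b = polyPair c d ↔ a = c ∧ b = d := by
  refine ⟨fun h => ?_, fun h => by rw [h.1, h.2]⟩
  unfold polyPair at h
  have hs : a + b = c + d := by
    rcases lt_trichotomy (a + b) (c + d) with hlt | heq | hlt
    · nlinarith
    · exact heq
    · nlinarith
  rw [hs] at h
  omega

/-- Patterns: the polynomials with natural number coefficients built from variables, numerals,
successor and the pairing polynomial. -/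
inductive Pat : Type where
  | var : ℕ → Pat
  | num : ℕ → Pat
  | succ : Pat → Pat
  | pair : Pat → Pat → Pat

namespace Pat

/-- The value of a pattern under an assignment of natural numbers to the variables. -/
def eval (g : ℕ → ℕ) : Pat → ℕ
  | var i => g i
  | num n => n
  | succ p => p.eval g + 1
  | pair p q => polyPair (p.eval g) (q.eval g)

/-- All variables of the pattern have index below `N`. -/
def VarsBelow (N : ℕ) : Pat → Prop
  | var i => i < N
  | num _ => True
  | succ p => p.VarsBelow N
  | pair p q => p.VarsBelow N ∧ q.VarsBelow N

end Pat

/-- One step of the rewriting system with the given rules, applied at the root. -/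
def RewriteStep (rules : List (Pat × Pat)) (x y : ℕ) : Prop :=
  ∃ r ∈ rules, ∃ g : ℕ → ℕ, r.1.eval g = x ∧ r.2.eval g = y

/-! ### A rewriting system evaluating partial recursive functions -/

namespace PatMachine

open Turing.ToPartrec StateTransition

/-- Configurations of a machine evaluating `Turing.ToPartrec.Code` in small steps. -/
inductive State : Type where
  | normal : Code → Cont → List ℕ → State
  | ret : Cont → List ℕ → State
  | halted : State

/-- The transition function. -/
def next : State → Option State
  | .normal .zero' k v => some (.ret k (0 :: v))
  | .normal .succ k v => some (.ret k [v.headI + 1])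
  | .normal .tail k v => some (.ret k v.tail)
  | .normal (.cons f fs) k v => some (.normal f (.cons₁ fs v k) v)
  | .normal (.comp f g) k v => some (.normal g (.comp f k) v)
  | .normal (.case f g) k v => some (match v.headI with
      | 0 => .normal f k v.tail
      | y + 1 => .normal g k (y :: v.tail))
  | .normal (.fix f) k v => some (.normal f (.fix f k) v)
  | .ret .halt _ => some .halted
  | .ret (.cons₁ fs as k) v => some (.normal fs (.cons₂ v k) as)
  | .ret (.cons₂ ns k) v => some (.ret k (ns.headI :: v))
  | .ret (.comp f k) v => some (.normal f k v)
  | .ret (.fix f k) v => some (match v.headI with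
      | 0 => .ret k v.tail
      | _ + 1 => .normal f (.fix f k) v.tail)
  | .halted => none

/-- The correspondence with the configurations of `Turing.ToPartrec.step`. -/
def Matches : Cfg → State → Prop
  | .halt _, s => s = .halted
  | .ret k v, s => s = .ret k v

theorem normal_reaches (c : Code) (k : Cont) (v : List ℕ) :
    ∃ s, Matches (stepNormal c k v) s ∧ Reaches₁ next (.normal c k v) s := by
  induction c generalizing k v with
  | zero' => exact ⟨_, rfl, .single rfl⟩
  | succ => exact ⟨_, rfl, .single rfl⟩
  | tail => exact ⟨_, rfl, .single rfl⟩
  | cons f fs ihf _ =>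
    obtain ⟨s, hs, h⟩ := ihf (.cons₁ fs v k) v
    exact ⟨s, hs, .head rfl h⟩
  | comp f g _ ihg =>
    obtain ⟨s, hs, h⟩ := ihg (.comp f k) v
    exact ⟨s, hs, .head rfl h⟩
  | case f g ihf ihg =>
    rcases hv : v.headI with _ | y
    · obtain ⟨s, hs, h⟩ := ihf k v.tail
      exact ⟨s, by simpa [stepNormal, hv] using hs, .head (by simp [next, hv]) h⟩
    · obtain ⟨s, hs, h⟩ := ihg k (y :: v.tail)
      exact ⟨s, by simpa [stepNormal, hv] using hs, .head (by simp [next, hv]) h⟩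
  | fix f ihf =>
    obtain ⟨s, hs, h⟩ := ihf (.fix f k) v
    exact ⟨s, hs, .head rfl h⟩

theorem ret_reaches (k : Cont) (v : List ℕ) :
    ∃ s, Matches (stepRet k v) s ∧ Reaches₁ next (.ret k v) s := by
  induction k generalizing v with
  | halt => exact ⟨_, rfl, .single rfl⟩
  | cons₁ fs as k _ =>
    obtain ⟨s, hs, h⟩ := normal_reaches fs (.cons₂ v k) as
    exact ⟨s, hs, .head rfl h⟩
  | cons₂ ns k ih =>
    obtain ⟨s, hs, h⟩ := ih (ns.headI :: v)
    exact ⟨s, hs, .head rfl h⟩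
  | comp f k _ =>
    obtain ⟨s, hs, h⟩ := normal_reaches f k v
    exact ⟨s, hs, .head rfl h⟩
  | fix f k ih =>
    rcases hv : v.headI with _ | y
    · obtain ⟨s, hs, h⟩ := ih v.tail
      exact ⟨s, by simpa [stepRet, hv] using hs, .head (by simp [next, hv]) h⟩
    · obtain ⟨s, hs, h⟩ := normal_reaches f (.fix f k) v.tail
      exact ⟨s, by simpa [stepRet, hv] using hs, .head (by simp [next, hv]) h⟩

theorem respects_next : Respects step next Matches := by
  rintro (v | ⟨k, v⟩) s hs
  · cases hs
    rfl
  · cases hs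
    exact ret_reaches k v

theorem next_eq_none_iff {s : State} : next s = none ↔ s = .halted := by
  refine ⟨fun h => ?_, fun h => h ▸ rfl⟩
  rcases s with ⟨c, k, v⟩ | ⟨k, v⟩ | _
  · cases c <;> simp [next] at h
  · cases k <;> simp [next] at h
  · rfl

theorem reaches_halted_iff (c : Code) (v : List ℕ) :
    Reaches next (.normal c .halt v) .halted ↔ (c.eval v).Dom := by
  obtain ⟨s, hs, h⟩ := normal_reaches c .halt v
  have hdom := tr_eval_dom respects_next hs
  rw [stepNormal_eval, ← reaches_eval h.to_reflTransGen] at hdom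
  have hdom' : (eval next (.normal c .halt v)).Dom ↔ (c.eval v).Dom := hdom
  rw [← hdom', Part.dom_iff_mem]
  constructor
  · exact fun hr => ⟨_, mem_eval.2 ⟨hr, rfl⟩⟩
  · rintro ⟨b, hb⟩
    obtain ⟨hb, hn⟩ := mem_eval.1 hb
    rwa [next_eq_none_iff.1 hn] at hb

/-- Lists are coded up to trailing zeros. -/
def encodeList : List ℕ → ℕ
  | [] => 0
  | a :: l => polyPair a (encodeList l)

/-- The number coding a program. -/
def encodeCode : Code → ℕ
  | .zero' => polyPair 0 0
  | .succ => polyPair 1 0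
  | .tail => polyPair 2 0
  | .cons f fs => polyPair 3 (polyPair (encodeCode f) (encodeCode fs))
  | .comp f g => polyPair 4 (polyPair (encodeCode f) (encodeCode g))
  | .case f g => polyPair 5 (polyPair (encodeCode f) (encodeCode g))
  | .fix f => polyPair 6 (encodeCode f)

/-- The number coding a continuation. -/
def encodeCont : Cont → ℕ
  | .halt => polyPair 0 0
  | .cons₁ fs as k => polyPair 1 (polyPair (encodeCode fs) (polyPair (encodeList as) (encodeCont k)))
  | .cons₂ ns k => polyPair 2 (polyPair (encodeList ns) (encodeCont k))
  | .comp f k => polyPair 3 (polyPair (encodeCode f) (encodeCont k))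
  | .fix f k => polyPair 4 (polyPair (encodeCode f) (encodeCont k))

/-- The number coding a configuration; the halted one is coded by zero. -/
def encodeState : State → ℕ
  | .normal c k v => polyPair 1 (polyPair (encodeCode c) (polyPair (encodeCont k) (encodeList v)))
  | .ret k v => polyPair 2 (polyPair (encodeCont k) (encodeList v))
  | .halted => 0

theorem encodeList_eq (v : List ℕ) : encodeList v = polyPair v.headI (encodeList v.tail) := by
  cases v <;> rfl

theorem polyPair_eq_encodeList {a b : ℕ} {v : List ℕ} :
    polyPair a b = encodeList v ↔ a = v.headI ∧ b = encodeList v.tail := by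
  rw [encodeList_eq, polyPair_inj]

/-- The pattern of the configuration `State.normal c k v`. -/
def normalPat (c k v : Pat) : Pat := .pair (.num 1) (.pair c (.pair k v))

/-- The pattern of the configuration `State.ret k v`. -/
def retPat (k v : Pat) : Pat := .pair (.num 2) (.pair k v)

/-- The pattern of a tagged tuple of length one. -/
def tag₁ (n : ℕ) (p : Pat) : Pat := .pair (.num n) p

/-- The pattern of a tagged tuple of length two. -/
def tag₂ (n : ℕ) (p q : Pat) : Pat := .pair (.num n) (.pair p q)

/-- The pattern of a tagged tuple of length three. -/
def tag₃ (n : ℕ) (p q r : Pat) : Pat := .pair (.num n) (.pair p (.pair q r))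

/-- The rewriting rules describing `next`. -/
def rules : List (Pat × Pat) :=
  [(normalPat (tag₁ 0 (.num 0)) (.var 0) (.var 1), retPat (.var 0) (.pair (.num 0) (.var 1))),
   (normalPat (tag₁ 1 (.num 0)) (.var 0) (.pair (.var 1) (.var 2)),
    retPat (.var 0) (.pair (.succ (.var 1)) (.num 0))),
   (normalPat (tag₁ 2 (.num 0)) (.var 0) (.pair (.var 1) (.var 2)), retPat (.var 0) (.var 2)),
   (normalPat (tag₂ 3 (.var 0) (.var 1)) (.var 2) (.var 3),
    normalPat (.var 0) (tag₃ 1 (.var 1) (.var 3) (.var 2)) (.var 3)),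
   (normalPat (tag₂ 4 (.var 0) (.var 1)) (.var 2) (.var 3),
    normalPat (.var 1) (tag₂ 3 (.var 0) (.var 2)) (.var 3)),
   (normalPat (tag₂ 5 (.var 0) (.var 1)) (.var 2) (.pair (.num 0) (.var 3)),
    normalPat (.var 0) (.var 2) (.var 3)),
   (normalPat (tag₂ 5 (.var 0) (.var 1)) (.var 2) (.pair (.succ (.var 3)) (.var 4)),
    normalPat (.var 1) (.var 2) (.pair (.var 3) (.var 4))),
   (normalPat (tag₁ 6 (.var 0)) (.var 1) (.var 2),
    normalPat (.var 0) (tag₂ 4 (.var 0) (.var 1)) (.var 2)),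
   (retPat (tag₁ 0 (.num 0)) (.var 0), .num 0),
   (retPat (tag₃ 1 (.var 0) (.var 1) (.var 2)) (.var 3),
    normalPat (.var 0) (tag₂ 2 (.var 3) (.var 2)) (.var 1)),
   (retPat (tag₂ 2 (.pair (.var 0) (.var 1)) (.var 2)) (.var 3),
    retPat (.var 2) (.pair (.var 0) (.var 3))),
   (retPat (tag₂ 3 (.var 0) (.var 1)) (.var 2), normalPat (.var 0) (.var 1) (.var 2)),
   (retPat (tag₂ 4 (.var 0) (.var 1)) (.pair (.num 0) (.var 2)), retPat (.var 1) (.var 2)),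
   (retPat (tag₂ 4 (.var 0) (.var 1)) (.pair (.succ (.var 2)) (.var 3)),
    normalPat (.var 0) (tag₂ 4 (.var 0) (.var 1)) (.var 3))]

theorem rules_varsBelow : ∀ r ∈ rules, r.1.VarsBelow 5 ∧ r.2.VarsBelow 5 := by
  simp [rules, normalPat, retPat, tag₁, tag₂, tag₃, Pat.VarsBelow]

/-- The assignment listing the given five values. -/
def assign (a b c d e : ℕ) : ℕ → ℕ
  | 0 => a
  | 1 => b
  | 2 => c
  | 3 => d
  | _ => e

theorem rewriteStep_iff {s : State} {y : ℕ} :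
    RewriteStep rules (encodeState s) y ↔ ∃ s', next s = some s' ∧ encodeState s' = y := by
  constructor
  · rintro ⟨r, hr, g, hx, rfl⟩
    simp only [rules, List.mem_cons, List.not_mem_nil, or_false] at hr
    have h0 : ∀ a b, polyPair a b = 0 ↔ a = 0 ∧ b = 0 := fun a b =>
      polyPair_inj (c := 0) (d := 0)
    rcases s with ⟨c, k, v⟩ | ⟨k, v⟩ | _
    · cases c <;> rcases hr with
        rfl | rfl | rfl | rfl | rfl | rfl | rfl | rfl | rfl | rfl | rfl | rfl | rfl | rfl <;>
      simp [normalPat, retPat, tag₁, tag₂, tag₃, Pat.eval, encodeState, encodeCode, next,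
        polyPair_inj, polyPair_eq_encodeList] at hx ⊢ <;>
      grind [encodeState, encodeCont, encodeCode, encodeList]
    · cases k <;> rcases hr with
        rfl | rfl | rfl | rfl | rfl | rfl | rfl | rfl | rfl | rfl | rfl | rfl | rfl | rfl <;>
      simp [normalPat, retPat, tag₁, tag₂, tag₃, Pat.eval, encodeState, encodeCont, next,
        polyPair_inj, polyPair_eq_encodeList] at hx ⊢ <;>
      grind [encodeState, encodeCont, encodeCode, encodeList]
    · rcases hr with
        rfl | rfl | rfl | rfl | rfl | rfl | rfl | rfl | rfl | rfl | rfl | rfl | rfl | rfl <;>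
      simp [normalPat, retPat, Pat.eval, encodeState, h0] at hx
  · rintro ⟨s', hs, rfl⟩
    have hstep : ∀ (i : Fin 14) (a b c d e : ℕ) {x y : ℕ},
        (rules.get i).1.eval (assign a b c d e) = x →
        (rules.get i).2.eval (assign a b c d e) = y → RewriteStep rules x y :=
      fun i a b c d e _ _ hx hy => ⟨_, rules.get_mem i, _, hx, hy⟩
    rcases s with ⟨c, k, v⟩ | ⟨k, v⟩ | _
    · have hv := encodeList_eq v
      cases c with
      | zero' =>
        cases hs
        exact hstep 0 (encodeCont k) (encodeList v) 0 0 0 rfl rfl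
      | succ =>
        cases hs
        rw [encodeState, hv]
        exact hstep 1 (encodeCont k) v.headI (encodeList v.tail) 0 0 rfl rfl
      | tail =>
        cases hs
        rw [encodeState, hv]
        exact hstep 2 (encodeCont k) v.headI (encodeList v.tail) 0 0 rfl rfl
      | cons f fs =>
        cases hs
        exact hstep 3 (encodeCode f) (encodeCode fs) (encodeCont k) (encodeList v) 0 rfl rfl
      | comp f g =>
        cases hs
        exact hstep 4 (encodeCode f) (encodeCode g) (encodeCont k) (encodeList v) 0 rfl rfl
      | case f g =>
        rw [encodeState, hv]
        rcases hh : v.headI with _ | y <;> simp only [next, hh, Option.some.injEq] at hs <;>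
          subst hs
        · exact hstep 5 (encodeCode f) (encodeCode g) (encodeCont k) (encodeList v.tail) 0 rfl rfl
        · exact hstep 6 (encodeCode f) (encodeCode g) (encodeCont k) y (encodeList v.tail) rfl rfl
      | fix f =>
        cases hs
        exact hstep 7 (encodeCode f) (encodeCont k) (encodeList v) 0 0 rfl rfl
    · cases k with
      | halt =>
        cases hs
        exact hstep 8 (encodeList v) 0 0 0 0 rfl rfl
      | cons₁ fs as k =>
        cases hs
        exact hstep 9 (encodeCode fs) (encodeList as) (encodeCont k) (encodeList v) 0 rfl rfl
      | cons₂ ns k =>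
        cases hs
        rw [encodeState, encodeCont, encodeList_eq ns]
        exact hstep 10 ns.headI (encodeList ns.tail) (encodeCont k) (encodeList v) 0 rfl rfl
      | comp f k =>
        cases hs
        exact hstep 11 (encodeCode f) (encodeCont k) (encodeList v) 0 0 rfl rfl
      | fix f k =>
        rw [encodeState, encodeList_eq v]
        rcases hh : v.headI with _ | y <;> simp only [next, hh, Option.some.injEq] at hs <;>
          subst hs
        · exact hstep 12 (encodeCode f) (encodeCont k) (encodeList v.tail) 0 0 rfl rfl
        · exact hstep 13 (encodeCode f) (encodeCont k) y (encodeList v.tail) 0 rfl rfl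
    · cases hs

theorem encodeState_eq_zero {s : State} : encodeState s = 0 ↔ s = .halted := by
  cases s <;> simp [encodeState, polyPair]

theorem rewrites_to_zero_iff (c : Code) (v : List ℕ) :
    Relation.ReflTransGen (RewriteStep rules) (encodeState (.normal c .halt v)) 0 ↔
      (c.eval v).Dom := by
  rw [← reaches_halted_iff]
  constructor
  · suffices ∀ x, Relation.ReflTransGen (RewriteStep rules) x 0 →
        ∀ s, encodeState s = x → Reaches next s .halted from fun h => this _ h _ rfl
    intro x hx
    induction hx using Relation.ReflTransGen.head_induction_on with
    | refl => exact fun s hs => encodeState_eq_zero.1 hs ▸ .refl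
    | head hxy _ ih =>
      rintro s rfl
      obtain ⟨s', hs, hs'⟩ := rewriteStep_iff.1 hxy
      exact .head hs (ih s' hs')
  · intro h
    exact h.lift encodeState fun s s' hs => rewriteStep_iff.2 ⟨s', hs, rfl⟩

end PatMachine

/-! ### Ladders in finite-dimensional algebras -/

section Ladder

variable {R : Type*} [Ring R]

/-- A certificate, in a finite-dimensional algebra over the rationals, for `Z` to be
diagonalizable with natural eigenvalues: `Y` counts the remaining steps down a ladder on which `U`
and `U'` move. -/
structure IsLadder (Z U U' Y : R) : Prop where
  lower : Y * U + U = U * Y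
  bottom : Y * (1 - U' * U) = 0
  top : (Z - Y) * (1 - U * U') = 0
  comm_lower : Z * U = U * Z
  comm_raise : Z * U' = U' * Z
  comm_count : Z * Y = Y * Z

theorem finite_setOf_eigenvalue [Algebra ℚ R] [Module.Finite ℚ R] (f : R →ₗ[ℚ] R) :
    {t : ℕ | ∃ w : R, w ≠ 0 ∧ f w = t * w}.Finite := by
  refine ((Module.End.finite_hasEigenvalue f).preimage
    (Nat.cast_injective (R := ℚ)).injOn).subset ?_
  rintro t ⟨w, hw, h⟩
  refine Module.End.hasEigenvalue_of_hasEigenvector (x := w) ⟨?_, hw⟩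
  rw [Module.End.mem_eigenspace_iff, h, Nat.cast_smul_eq_nsmul, nsmul_eq_mul]

theorem exists_pow_eq_zero_of_mul_eq [Algebra ℚ R] [Module.Finite ℚ R] {D S : R}
    (h : D * S = S * D + S) : ∃ N, S ^ N = 0 := by
  by_contra! hS
  have hpow : ∀ k : ℕ, D * S ^ k - S ^ k * D = k * S ^ k := by
    intro k
    induction k with
    | zero => simp
    | succ k ih =>
      have ih' : D * S ^ k = S ^ k * D + k * S ^ k := by rw [← ih]; abel
      rw [pow_succ, ← mul_assoc, ih', add_mul, mul_assoc _ D, h]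
      push_cast
      noncomm_ring
  refine Set.infinite_univ ((finite_setOf_eigenvalue
    (LinearMap.mulLeft ℚ D - LinearMap.mulRight ℚ D)).subset fun k _ => ⟨S ^ k, hS k, ?_⟩)
  simpa using hpow k

theorem one_sub_mul_ne_zero [Nontrivial R] {S S' : R} (h : ∃ N, S ^ N = 0) : 1 - S * S' ≠ 0 := by
  obtain ⟨N, hN⟩ := h
  intro hS
  have hpow : ∀ k, S ^ k * S' ^ k = 1 := by
    intro k
    induction k with
    | zero => simp
    | succ k ih =>
      rw [pow_succ, pow_succ', mul_assoc, ← mul_assoc S, ← sub_eq_zero.1 hS, one_mul, ih]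
  simpa [hN] using hpow N

theorem mul_list_prod_comm {Z b : R} (h : Commute b Z) (l : List ℕ) :
    Commute b (l.map fun j : ℕ => Z - j).prod := by
  refine Commute.list_prod_right _ _ fun x hx => ?_
  obtain ⟨j, _, rfl⟩ := List.mem_map.1 hx
  exact h.sub_right (Nat.cast_commute j b).symm

theorem IsLadder.exists_list_prod_eq_zero [Algebra ℚ R] [Module.Finite ℚ R] {Z U U' Y : R}
    (h : IsLadder Z U U' Y) : ∃ l : List ℕ, (l.map fun j : ℕ => Z - j).prod = 0 := by
  obtain ⟨N, hN⟩ : ∃ N, U ^ N = 0 := by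
    refine exists_pow_eq_zero_of_mul_eq (D := -Y) ?_
    rw [neg_mul, mul_neg, ← h.lower]
    abel
  have hYpow : ∀ k : ℕ, Y * U ^ k = U ^ k * (Y - k) := by
    intro k
    induction k with
    | zero => simp
    | succ k ih =>
      have hY : Y * U = U * (Y - 1) := by rw [mul_sub, ← h.lower]; noncomm_ring
      have hk : (Y - k) * U = U * (Y - (k + 1)) := by
        rw [sub_mul, hY, Nat.cast_comm]
        noncomm_ring
      rw [pow_succ, ← mul_assoc, ih, mul_assoc, hk]
      push_cast
      noncomm_ring
  obtain ⟨F, hF⟩ : ∃ F, F = 1 - U * U' := ⟨_, rfl⟩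
  have hYZ : Y * F = Z * F := by rw [eq_comm, ← sub_eq_zero, ← sub_mul, hF, h.top]
  have hdescend : ∀ k : ℕ, (∃ l : List ℕ, (l.map fun j : ℕ => Z - j).prod * (U ^ k * F) = 0) →
      ∃ l : List ℕ, (l.map fun j : ℕ => Z - j).prod * F = 0 := by
    intro k
    induction k with
    | zero => simp
    | succ k ih =>
      rintro ⟨l, hl⟩
      refine ih ⟨k :: l, ?_⟩
      rw [List.map_cons, List.prod_cons, mul_assoc]
      set P := (l.map fun j : ℕ => Z - j).prod
      have hPU : U * P = P * U := mul_list_prod_comm h.comm_lower.symm l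
      have hPY : Y * P = P * Y := mul_list_prod_comm h.comm_count.symm l
      have hPZ : Z * P = P * Z := mul_list_prod_comm (Commute.refl Z) l
      have hZU : Z * U ^ k = U ^ k * Z := (Commute.pow_right h.comm_lower k)
      have hw : U * (P * (U ^ k * F)) = 0 := by
        rw [← hl, pow_succ']
        simp only [← mul_assoc, hPU]
      have hYw : Y * (P * (U ^ k * F)) = 0 := by
        have := congrArg (· * (P * (U ^ k * F))) h.bottom
        simpa [mul_sub, sub_mul, mul_assoc, hw] using this
      rw [← hYw, ← mul_assoc Y, hPY, mul_assoc P, ← mul_assoc Y, hYpow, mul_assoc (U ^ k), sub_mul Y,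
        hYZ, sub_mul, ← mul_assoc Z, hPZ, mul_assoc P, ← mul_assoc Z, hZU, mul_sub, mul_sub,
        mul_assoc (U ^ k) Z, (Nat.cast_commute k P).left_comm, (Nat.cast_commute k (U ^ k)).left_comm]
  obtain ⟨l, hl⟩ := hdescend N ⟨[], by simp [hN]⟩
  refine ⟨l, ?_⟩
  set P := (l.map fun j : ℕ => Z - j).prod
  have hPU : U * P = P * U := mul_list_prod_comm h.comm_lower.symm l
  have hP : P = U * P * U' := by
    rw [hPU, mul_assoc, ← sub_eq_zero]
    simpa [hF, mul_sub] using hl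
  have hpow : ∀ k, P = U ^ k * P * U' ^ k := by
    intro k
    induction k with
    | zero => simp
    | succ k ih =>
      conv_lhs => rw [ih, hP]
      rw [pow_succ, pow_succ']
      simp only [mul_assoc]
  rw [hpow N, hN, zero_mul, zero_mul]

/-- Multiplying a nonzero element by a suitable polynomial in `Z` yields an eigenvector of `Z`. -/
theorem exists_mul_eq_natCast_mul {Z w : R} (hw : w ≠ 0) (l : List ℕ)
    (hl : (l.map fun j : ℕ => Z - j).prod * w = 0) :
    ∃ (k : ℕ) (a : R), (∀ b, Commute b Z → Commute b a) ∧ a * w ≠ 0 ∧ Z * (a * w) = k * (a * w) := by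
  induction l with
  | nil => simp [hw] at hl
  | cons j l ih =>
    by_cases h : (l.map fun j : ℕ => Z - j).prod * w = 0
    · exact ih h
    · refine ⟨j, _, fun b hb => mul_list_prod_comm hb l, h, ?_⟩
      rw [List.map_cons, List.prod_cons, mul_assoc, sub_mul, sub_eq_zero] at hl
      exact hl

end Ladder

/-! ### The polynomial system attached to a rewriting system -/

namespace RingTerm

/-- The difference of two terms. -/
def sub (p q : RingTerm) : RingTerm := .add p (.neg q)

/-- The numeral of a natural number. -/
def numeral : ℕ → RingTerm
  | 0 => .zero
  | n + 1 => .add (numeral n) .one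

variable {R : Type*} [Ring R]

@[simp]
theorem eval_sub (v : ℕ → R) (p q : RingTerm) : (sub p q).eval v = p.eval v - q.eval v := by
  simp [sub, eval, sub_eq_add_neg]

@[simp]
theorem eval_numeral (v : ℕ → R) (n : ℕ) : (numeral n).eval v = n := by
  induction n with
  | zero => simp [numeral, eval]
  | succ n ih => simp [numeral, eval, ih]

theorem map_eval {R' : Type*} [Ring R'] (φ : R →+* R') (v : ℕ → R) (p : RingTerm) :
    φ (p.eval v) = p.eval fun i => φ (v i) := by
  induction p <;> simp_all [eval]

end RingTerm

/-- The ring term obtained from a pattern by substituting terms for the variables. -/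
def Pat.term (f : ℕ → RingTerm) : Pat → RingTerm
  | .var i => f i
  | .num n => .numeral n
  | .succ p => .add (p.term f) .one
  | .pair p q => .add (.mul (.add (p.term f) (q.term f)) (.add (p.term f) (q.term f))) (p.term f)

/-- On a common eigenvector `w` of the variables, a pattern acts through its value. -/
theorem Pat.eval_term_mul {R : Type*} [Ring R] {v : ℕ → R} {f : ℕ → RingTerm} {g : ℕ → ℕ} {w : R}
    {N : ℕ} (h : ∀ i < N, (f i).eval v * w = g i * w) {p : Pat} (hp : p.VarsBelow N) :
    (p.term f).eval v * w = p.eval g * w := by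
  induction p with
  | var i => exact h i hp
  | num n => simp [term, Pat.eval]
  | succ p ih => simp [term, Pat.eval, RingTerm.eval, add_mul, ih hp]
  | pair p q ihp ihq =>
    have hs : ((p.term f).eval v + (q.term f).eval v) * w = (p.eval g + q.eval g : ℕ) * w := by
      rw [add_mul, ihp hp.1, ihq hp.2]
      push_cast
      rw [add_mul]
    simp only [term, RingTerm.eval, Pat.eval, polyPair]
    rw [add_mul, mul_assoc, hs, ← mul_assoc, ← Nat.cast_comm, mul_assoc, hs, ihp hp.1, ← mul_assoc,
      ← add_mul]
    push_cast
    rfl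

/-- A term vanishing exactly when the rule `r` rewrites variable `5` to variable `6`. -/
def ruleTerm (r : Pat × Pat) : RingTerm :=
  .add (.mul (.sub (.var 5) (r.1.term .var)) (.sub (.var 5) (r.1.term .var)))
    (.mul (.sub (.var 6) (r.2.term .var)) (.sub (.var 6) (r.2.term .var)))

/-- A term vanishing exactly when one of the rules rewrites variable `5` to variable `6`. -/
def stepTerm (rules : List (Pat × Pat)) : RingTerm :=
  rules.foldr (fun r p => .mul (ruleTerm r) p) .one

theorem eval_ruleTerm_mul {R : Type*} [Ring R] {v : ℕ → R} {g : ℕ → ℕ} {w : R}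
    (h : ∀ i < 7, v i * w = g i * w) {r : Pat × Pat} (hr : r.1.VarsBelow 5 ∧ r.2.VarsBelow 5) :
    (ruleTerm r).eval v * w =
      (((g 5 - r.1.eval g) * (g 5 - r.1.eval g) + (g 6 - r.2.eval g) * (g 6 - r.2.eval g) : ℤ) : R)
        * w := by
  have hsq : ∀ (A : R) (c : ℤ), A * w = c * w → A * A * w = ((c * c : ℤ) : R) * w := by
    intro A c hA
    rw [mul_assoc, hA, ← mul_assoc, ← Int.cast_comm, mul_assoc, hA, Int.cast_mul, mul_assoc]
  have h' : ∀ i < 5, (RingTerm.var i).eval v * w = g i * w := fun i hi => h i (by omega)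
  simp only [ruleTerm, RingTerm.eval, RingTerm.eval_sub]
  rw [add_mul, Int.cast_add, add_mul, hsq _ (g 5 - r.1.eval g), hsq _ (g 6 - r.2.eval g)]
  · simp [sub_mul, h 6, Pat.eval_term_mul h' hr.2]
  · simp [sub_mul, h 5, Pat.eval_term_mul h' hr.1]

/-- On a common eigenvector of the variables the step term acts through an integer which vanishes
exactly when one of the rules applies. -/
theorem exists_eval_stepTerm_mul {R : Type*} [Ring R] {v : ℕ → R} {g : ℕ → ℕ} {w : R}
    (h : ∀ i < 7, v i * w = g i * w) {rules : List (Pat × Pat)}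
    (hr : ∀ r ∈ rules, r.1.VarsBelow 5 ∧ r.2.VarsBelow 5) :
    ∃ c : ℤ, (stepTerm rules).eval v * w = c * w ∧
      (c = 0 ↔ ∃ r ∈ rules, r.1.eval g = g 5 ∧ r.2.eval g = g 6) := by
  induction rules with
  | nil => exact ⟨1, by simp [stepTerm, RingTerm.eval], by simp⟩
  | cons r rules ih =>
    obtain ⟨c, hc, hc'⟩ := ih fun r hmem => hr r (List.mem_cons_of_mem _ hmem)
    have hrule := eval_ruleTerm_mul h (hr r List.mem_cons_self)
    refine ⟨((g 5 - r.1.eval g) * (g 5 - r.1.eval g) +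
      (g 6 - r.2.eval g) * (g 6 - r.2.eval g) : ℤ) * c, ?_, ?_⟩
    · have : (stepTerm (r :: rules)).eval v = (ruleTerm r).eval v * (stepTerm rules).eval v := rfl
      rw [this, mul_assoc, hc, ← mul_assoc, ← Int.cast_comm, mul_assoc, hrule, ← mul_assoc,
        ← Int.cast_mul, mul_comm c]
    · rw [mul_eq_zero, hc', List.exists_mem_cons_iff]
      refine or_congr ⟨fun h => ?_, fun ⟨h₁, h₂⟩ => by simp [h₁, h₂]⟩ Iff.rfl
      constructor <;> zify <;> nlinarith

theorem exists_of_eval_stepTerm_mul {R : Type*} [Ring R] [Algebra ℚ R] {v : ℕ → R} {g : ℕ → ℕ}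
    {w : R} (hw : w ≠ 0) (h : ∀ i < 7, v i * w = g i * w) {rules : List (Pat × Pat)}
    (hr : ∀ r ∈ rules, r.1.VarsBelow 5 ∧ r.2.VarsBelow 5)
    (h0 : (stepTerm rules).eval v * w = 0) :
    ∃ r ∈ rules, r.1.eval g = g 5 ∧ r.2.eval g = g 6 := by
  obtain ⟨c, hc, hc'⟩ := exists_eval_stepTerm_mul h hr
  refine hc'.1 ?_
  rw [h0, ← zsmul_eq_mul, ← Int.cast_smul_eq_zsmul ℚ, eq_comm, smul_eq_zero] at hc
  simpa [hw] using hc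

theorem eval_stepTerm_mul_eq_zero {R : Type*} [Ring R] {v : ℕ → R} {g : ℕ → ℕ}
    {w : R} (h : ∀ i < 7, v i * w = g i * w) {rules : List (Pat × Pat)}
    (hr : ∀ r ∈ rules, r.1.VarsBelow 5 ∧ r.2.VarsBelow 5)
    (h0 : ∃ r ∈ rules, r.1.eval g = g 5 ∧ r.2.eval g = g 6) :
    (stepTerm rules).eval v * w = 0 := by
  obtain ⟨c, hc, hc'⟩ := exists_eval_stepTerm_mul h hr
  rw [hc, hc'.2 h0, Int.cast_zero, zero_mul]

/-- The terms expressing that `Z`, `U`, `U'`, `Y` form a ladder. -/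
def ladderTerms (Z U U' Y : RingTerm) : List RingTerm :=
  [.sub (.add (.mul Y U) U) (.mul U Y),
   .mul Y (.sub .one (.mul U' U)),
   .mul (.sub Z Y) (.sub .one (.mul U U')),
   .sub (.mul Z U) (.mul U Z),
   .sub (.mul Z U') (.mul U' Z),
   .sub (.mul Z Y) (.mul Y Z)]

/-- The part of the system which does not depend on the input. Variables below `7` are the
naturals of a rewriting step: the values of the pattern variables, and in positions `5` and `6` the
old and the new configuration. They are followed by their ladders. Variables `28` and `29` shift
time, `30` is the clock and `31` the input. -/
def systemTerms (rules : List (Pat × Pat)) (start : Pat) : List RingTerm :=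
  ((List.range 7).flatMap fun i => (List.range 7).map fun j =>
      .sub (.mul (.var i) (.var j)) (.mul (.var j) (.var i))) ++
  ((List.range 7).flatMap fun i =>
      ladderTerms (.var i) (.var (7 + i)) (.var (14 + i)) (.var (21 + i))) ++
  ((List.range 7).map fun i => .sub (.mul (.var 30) (.var i)) (.mul (.var i) (.var 30))) ++
  [.sub (.mul (.var 30) (.var 28)) (.add (.mul (.var 28) (.var 30)) (.var 28)),
   .mul (.var 30) (.sub .one (.mul (.var 28) (.var 29))),
   .sub (.mul (.var 5) (.var 28)) (.mul (.var 28) (.var 6)),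
   .mul (.sub (.var 5) (start.term fun _ => .var 31)) (.sub .one (.mul (.var 28) (.var 29))),
   .mul (.var 5) (.sub .one (.mul (.var 29) (.var 28))),
   stepTerm ((.num 0, .num 0) :: rules)]

/-- The term fixing the value of the input variable. -/
def inputTerm (n : ℕ) : RingTerm := .sub (.var 31) (.numeral n)

/-- A ring together with an assignment satisfying the system. -/
structure IsModel {R : Type*} [Ring R] (rules : List (Pat × Pat)) (start : Pat) (n : ℕ)
    (v : ℕ → R) : Prop where
  comm : ∀ i < 7, ∀ j < 7, v i * v j = v j * v i
  ladder : ∀ i < 7, IsLadder (v i) (v (7 + i)) (v (14 + i)) (v (21 + i))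
  clock_comm : ∀ i < 7, v 30 * v i = v i * v 30
  clock_shift : v 30 * v 28 = v 28 * v 30 + v 28
  clock_start : v 30 * (1 - v 28 * v 29) = 0
  shift : v 5 * v 28 = v 28 * v 6
  start : (v 5 - (start.term fun _ => .var 31).eval v) * (1 - v 28 * v 29) = 0
  halt : v 5 * (1 - v 29 * v 28) = 0
  step : (stepTerm ((.num 0, .num 0) :: rules)).eval v = 0
  input : v 31 = n

theorem isModel_iff {R : Type*} [Ring R] {rules : List (Pat × Pat)} {start : Pat} {n : ℕ}
    {v : ℕ → R} : (∀ p ∈ inputTerm n :: systemTerms rules start, p.eval v = 0) ↔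
      IsModel rules start n v := by
  have hladder : ∀ i, (∀ p ∈ ladderTerms (.var i) (.var (7 + i)) (.var (14 + i)) (.var (21 + i)),
      p.eval v = 0) ↔ IsLadder (v i) (v (7 + i)) (v (14 + i)) (v (21 + i)) := by
    intro i
    simp only [ladderTerms, List.forall_mem_cons, RingTerm.eval, RingTerm.eval_sub,
      List.not_mem_nil, false_imp_iff, implies_true, and_true, sub_eq_zero]
    exact ⟨fun ⟨h₁, h₂, h₃, h₄, h₅, h₆⟩ => ⟨h₁, h₂, h₃, h₄, h₅, h₆⟩,
      fun ⟨h₁, h₂, h₃, h₄, h₅, h₆⟩ => ⟨h₁, h₂, h₃, h₄, h₅, h₆⟩⟩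
  simp only [systemTerms, List.forall_mem_cons, List.forall_mem_append,
    List.forall_mem_flatMap, hladder, List.forall_mem_map, List.mem_range, inputTerm,
    RingTerm.eval_sub, RingTerm.eval, RingTerm.eval_numeral, sub_eq_zero,
    List.not_mem_nil, false_imp_iff, implies_true, and_true]
  exact ⟨fun ⟨h₁, ⟨⟨h₂, h₃⟩, h₄⟩, h₅, h₆, h₇, h₈, h₉, h⟩ =>
      ⟨h₂, h₃, h₄, h₅, h₆, h₇, h₈, h₉, h, h₁⟩,
    fun ⟨h₂, h₃, h₄, h₅, h₆, h₇, h₈, h₉, h, h₁⟩ =>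
      ⟨h₁, ⟨⟨h₂, h₃⟩, h₄⟩, h₅, h₆, h₇, h₈, h₉, h⟩⟩

/-! ### Models describe halting runs -/

namespace IsModel

variable {R : Type*} [Ring R] [Algebra ℚ R] [Module.Finite ℚ R] {rules : List (Pat × Pat)}
  {start : Pat} {n : ℕ} {v : ℕ → R}

theorem exists_common_eigenvector (hv : IsModel rules start n v) {w₀ : R} (hw₀ : w₀ ≠ 0) {M : ℕ}
    (hM : M ≤ 7) :
    ∃ (w : R) (z : ℕ → ℕ), w ≠ 0 ∧ (∀ i < M, v i * w = z i * w) ∧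
      ∀ b, (∀ i < 7, b * v i = v i * b) → ∀ k : ℕ, b * w₀ = k * w₀ → b * w = k * w := by
  induction M with
  | zero => exact ⟨w₀, 0, hw₀, by simp, fun b _ k hb => hb⟩
  | succ M ih =>
    obtain ⟨w, z, hw, hz, hb⟩ := ih (by omega)
    obtain ⟨l, hl⟩ := (hv.ladder M (by omega)).exists_list_prod_eq_zero
    obtain ⟨k, a, ha, haw, hk⟩ := exists_mul_eq_natCast_mul hw l (by rw [hl, zero_mul])
    have hpres : ∀ (b : R) (k : ℕ), b * v M = v M * b → b * w = k * w →
        b * (a * w) = k * (a * w) := by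
      intro b k hb hbw
      rw [← mul_assoc, (ha b hb).eq, mul_assoc, hbw, (Nat.cast_commute k a).left_comm]
    refine ⟨a * w, Function.update z M k, haw, fun i hi => ?_, fun b hbv k hbw => ?_⟩
    · rcases Nat.lt_succ_iff_lt_or_eq.1 hi with h | rfl
      · rw [Function.update_of_ne h.ne]
        exact hpres _ _ (hv.comm i (by omega) M (by omega)) (hz i h)
      · rwa [Function.update_self]
    · exact hpres b k (hbv M (by omega)) (hb b hbv k hbw)

theorem rewrites_to_zero [Nontrivial R] (hv : IsModel rules start n v)
    (hr : ∀ r ∈ rules, r.1.VarsBelow 5 ∧ r.2.VarsBelow 5) (hs : start.VarsBelow 1) :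
    Relation.ReflTransGen (RewriteStep rules) (start.eval fun _ => n) 0 := by
  obtain ⟨T, hT⟩ := (finite_setOf_eigenvalue (LinearMap.mulLeft ℚ (v 30))).bddAbove
  have hrun : ∀ (m t x : ℕ) (w₀ : R), T < t + m → w₀ ≠ 0 → v 30 * w₀ = t * w₀ →
      v 5 * w₀ = x * w₀ → Relation.ReflTransGen (RewriteStep rules) x 0 := by
    intro m
    induction m with
    | zero =>
      intro t x w₀ ht hw₀ hclock _
      exact absurd (hT ⟨w₀, hw₀, hclock⟩) (by simpa using ht)
    | succ m ih =>
      intro t x w₀ ht hw₀ hclock hx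
      obtain ⟨w, z, hw, hz, hb⟩ := hv.exists_common_eigenvector hw₀ le_rfl
      have hclock' := hb _ hv.clock_comm t hclock
      have hx' := hb _ (fun i hi => hv.comm 5 (by norm_num) i hi) x hx
      have hzx : z 5 = x := by
        have := (hz 5 (by norm_num)).symm.trans hx'
        rw [← nsmul_eq_mul, ← nsmul_eq_mul, ← Nat.cast_smul_eq_nsmul ℚ,
          ← Nat.cast_smul_eq_nsmul ℚ] at this
        exact_mod_cast smul_left_injective ℚ hw this
      by_cases hSw : v 28 * w = 0
      · have h0 := congrArg (· * w) hv.halt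
        simp only [mul_assoc, sub_mul, hSw, one_mul, mul_zero, sub_zero, zero_mul, hx'] at h0
        rw [← nsmul_eq_mul, ← Nat.cast_smul_eq_nsmul ℚ, smul_eq_zero] at h0
        have : x = 0 := by simpa [hw] using h0
        rw [this]
      · obtain ⟨r, hmem, h5, h6⟩ := exists_of_eval_stepTerm_mul hw hz
          (rules := (.num 0, .num 0) :: rules)
          (List.forall_mem_cons.2 ⟨⟨trivial, trivial⟩, hr⟩) (by rw [hv.step, zero_mul])
        rcases List.mem_cons.1 hmem with rfl | hmem
        · rw [← hzx, ← h5]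
          exact .refl
        · refine .head (b := z 6) ⟨r, hmem, z, h5.trans hzx, h6⟩
            (ih (t + 1) (z 6) (v 28 * w) (by omega) hSw ?_ ?_)
          · rw [← mul_assoc, hv.clock_shift, add_mul, mul_assoc, hclock',
              ← (Nat.cast_commute t _).left_comm]
            push_cast
            rw [add_mul, one_mul]
          · rw [← mul_assoc, hv.shift, mul_assoc, hz 6 (by norm_num),
              ← (Nat.cast_commute (z 6) _).left_comm]
  refine hrun (T + 1) 0 _ (1 - v 28 * v 29) (by omega)
    (one_sub_mul_ne_zero (exists_pow_eq_zero_of_mul_eq hv.clock_shift))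
    (by simpa using hv.clock_start) ?_
  rw [← Pat.eval_term_mul (v := v) (f := fun _ => .var 31) (fun _ _ => by
    simp [RingTerm.eval, hv.input]) hs, ← sub_eq_zero, ← sub_mul, hv.start]

end IsModel

/-! ### Halting runs give models -/

theorem Pat.eval_congr {N : ℕ} {g g' : ℕ → ℕ} (h : ∀ i < N, g i = g' i) {p : Pat}
    (hp : p.VarsBelow N) : p.eval g = p.eval g' := by
  induction p with
  | var i => exact h i hp
  | num n => rfl
  | succ p ih => simp only [Pat.eval, ih hp]
  | pair p q ihp ihq => simp only [Pat.eval, ihp hp.1, ihq hp.2]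

/-- The data of a run of length `T` from `x` to `0`: the row `z t` lists the values of the pattern
variables in step `t`, followed by the configurations before and after that step. -/
structure IsRun (rules : List (Pat × Pat)) (x T : ℕ) (z : ℕ → ℕ → ℕ) : Prop where
  start : z 0 5 = x
  halt : z T 5 = 0
  step : ∀ t, ∃ r ∈ (.num 0, .num 0) :: rules, r.1.eval (z t) = z t 5 ∧ r.2.eval (z t) = z t 6
  link : ∀ t < T, z t 6 = z (t + 1) 5

theorem exists_isRun {rules : List (Pat × Pat)}
    (hr : ∀ r ∈ rules, r.1.VarsBelow 5 ∧ r.2.VarsBelow 5) {x : ℕ}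
    (h : Relation.ReflTransGen (RewriteStep rules) x 0) : ∃ T z, IsRun rules x T z := by
  induction h using Relation.ReflTransGen.head_induction_on with
  | refl => exact ⟨0, 0, rfl, rfl, fun _ => ⟨_, List.mem_cons_self, rfl, rfl⟩, by simp⟩
  | @head x y hxy _ ih =>
    obtain ⟨T, z, hz⟩ := ih
    obtain ⟨r, hmem, g, hx, hy⟩ := hxy
    let g' : ℕ → ℕ := fun i => if i < 5 then g i else if i = 5 then x else y
    have hg : ∀ i < 5, g' i = g i := fun i hi => if_pos hi
    refine ⟨T + 1, fun t => t.casesOn g' z, rfl, hz.halt, fun t => ?_, fun t ht => ?_⟩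
    · cases t with
      | zero =>
        exact ⟨r, List.mem_cons_of_mem _ hmem, (Pat.eval_congr hg (hr r hmem).1).trans hx,
          (Pat.eval_congr hg (hr r hmem).2).trans hy⟩
      | succ t => exact hz.step t
    · cases t with
      | zero => exact hz.start.symm
      | succ t => exact hz.link t (by omega)

section Operators

variable {ι : Type*}

/-- The diagonal operator with the given natural number entries. -/
def diagOp (f : ι → ℕ) : Module.End ℚ (ι → ℚ) where
  toFun φ i := f i * φ i
  map_add' φ ψ := by ext i; simp [mul_add]
  map_smul' c φ := by ext i; simp [mul_left_comm]

/-- The operator pulling back along the partial map `f` defined where `p` holds. -/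
def pullOp (p : ι → Prop) [DecidablePred p] (f : ι → ι) : Module.End ℚ (ι → ℚ) where
  toFun φ i := if p i then φ (f i) else 0
  map_add' φ ψ := by ext i; by_cases h : p i <;> simp [h]
  map_smul' c φ := by ext i; by_cases h : p i <;> simp [h]

@[simp]
theorem diagOp_apply (f : ι → ℕ) (φ : ι → ℚ) (i : ι) : diagOp f φ i = f i * φ i := rfl

@[simp]
theorem pullOp_apply (p : ι → Prop) [DecidablePred p] (f : ι → ι) (φ : ι → ℚ) (i : ι) :
    pullOp p f φ i = if p i then φ (f i) else 0 := rfl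

theorem diagOp_comm (f g : ι → ℕ) : diagOp f * diagOp g = diagOp g * diagOp f := by
  ext φ i
  simp [mul_left_comm]

theorem diagOp_mul_pullOp (f g : ι → ℕ) (p : ι → Prop) [DecidablePred p] (s : ι → ι)
    (h : ∀ i, p i → f i = g (s i)) : diagOp f * pullOp p s = pullOp p s * diagOp g := by
  ext φ i
  by_cases hi : p i <;> simp [hi, h]

theorem diagOp_mul_one_sub (f : ι → ℕ) (p q : ι → Prop) [DecidablePred p] [DecidablePred q]
    (s u : ι → ι) (h : ∀ i, p i → q (s i) ∧ u (s i) = i) (h0 : ∀ i, ¬ p i → f i = 0) :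
    diagOp f * (1 - pullOp p s * pullOp q u) = 0 := by
  ext φ i
  by_cases hi : p i <;> simp [hi, h, h0]

theorem isLadder_diagOp_pullOp (z y : ι → ℕ) (p q : ι → Prop) [DecidablePred p] [DecidablePred q]
    (s u : ι → ι) (hp : ∀ i, p i → q (s i) ∧ u (s i) = i ∧ y i + 1 = y (s i) ∧ z i = z (s i))
    (hp' : ∀ i, ¬ p i → y i = z i) (hq : ∀ i, q i → p (u i) ∧ s (u i) = i ∧ z i = z (u i))
    (hq' : ∀ i, ¬ q i → y i = 0) :
    IsLadder (diagOp z) (pullOp p s) (pullOp q u) (diagOp y) where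
  lower := by
    ext φ i
    by_cases hi : p i
    · simp [hi, ← (hp i hi).2.2.1, add_mul]
    · simp [hi]
  bottom := diagOp_mul_one_sub y q p u s (fun i hi => ⟨(hq i hi).1, (hq i hi).2.1⟩) hq'
  top := by
    ext φ i
    by_cases hi : p i
    · simp [hi, hp i hi]
    · simp [hi, hp']
  comm_lower := diagOp_mul_pullOp z z p s fun i hi => (hp i hi).2.2.2
  comm_raise := diagOp_mul_pullOp z z q u fun i hi => (hq i hi).2.2
  comm_count := diagOp_comm z y

end Operators

namespace IsRun

variable {rules : List (Pat × Pat)} {x T D n : ℕ} {z : ℕ → ℕ → ℕ} {start : Pat}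

/-- The operator shifting the block of time `t - 1` to that of time `t`. -/
def shiftOp (T D : ℕ) : Module.End ℚ (Fin (T + 1) × Fin D → ℚ) :=
  pullOp (fun a => (a.1 : ℕ) ≠ 0) fun a => (⟨a.1 - 1, by omega⟩, a.2)

/-- The operator shifting the block of time `t + 1` to that of time `t`. -/
def shiftBackOp (T D : ℕ) : Module.End ℚ (Fin (T + 1) × Fin D → ℚ) :=
  pullOp (fun a => (a.1 : ℕ) ≠ T) fun a => (Fin.ofNat (T + 1) (a.1 + 1), a.2)

/-- The lowering operator of the ladder of `z t`. Within the block of time `t`, the basis is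
divided into cycles of length `z t + 1`. -/
def lowerOp (T D : ℕ) (z : ℕ → ℕ) : Module.End ℚ (Fin (T + 1) × Fin D → ℚ) :=
  pullOp (fun a => (a.2 : ℕ) % (z a.1 + 1) ≠ 0) fun a => (a.1, ⟨a.2 - 1, by omega⟩)

/-- The raising operator of the ladder of `z t`. -/
def raiseOp (T D : ℕ) [NeZero D] (z : ℕ → ℕ) : Module.End ℚ (Fin (T + 1) × Fin D → ℚ) :=
  pullOp (fun a => ((a.2 : ℕ) + 1) % (z a.1 + 1) ≠ 0) fun a => (a.1, Fin.ofNat D (a.2 + 1))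

/-- The counting operator of the ladder of `z t`. -/
def countOp (T D : ℕ) (z : ℕ → ℕ) : Module.End ℚ (Fin (T + 1) × Fin D → ℚ) :=
  diagOp fun a => z a.1 - a.2 % (z a.1 + 1)

theorem succ_mod_of_ne_zero {a m : ℕ} (h : (a + 1) % m ≠ 0) : (a + 1) % m = a % m + 1 := by
  rcases m.eq_zero_or_pos with rfl | hm
  · simp
  have h1 := Nat.mod_lt a hm
  rw [Nat.add_mod_eq_ite] at h ⊢
  rcases Nat.lt_or_ge 1 m with h2 | h2
  · rw [Nat.mod_eq_of_lt h2] at h ⊢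
    split_ifs at h ⊢ <;> omega
  · obtain rfl : m = 1 := by omega
    simp [Nat.mod_one] at h

theorem isLadder [NeZero D] {z : ℕ → ℕ} (hD : ∀ t ≤ T, z t + 1 ∣ D) :
    IsLadder (diagOp fun a : Fin (T + 1) × Fin D => z a.1) (lowerOp T D z) (raiseOp T D z)
      (countOp T D z) := by
  refine isLadder_diagOp_pullOp _ _ _ _ _ _ ?_ ?_ ?_ ?_
  · rintro ⟨t, j, hj⟩ h
    obtain _ | j := j
    · simp at h
    have h' := succ_mod_of_ne_zero h
    have hlt : (j + 1) % (z t + 1) < z t + 1 := Nat.mod_lt _ (Nat.succ_pos _)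
    simp only at h h' hlt ⊢
    refine ⟨by simpa using h, ?_, ?_, trivial⟩
    · ext <;> simp [Nat.mod_eq_of_lt hj]
    · simp only [Nat.add_sub_cancel]
      omega
  · rintro ⟨t, j⟩ h
    simp only [not_not] at h
    simp [h]
  · rintro ⟨t, j, hj⟩ h
    have hne : j + 1 ≠ D := by
      rintro rfl
      exact h (Nat.mod_eq_zero_of_dvd (hD t (by omega)))
    have hlt : j + 1 < D := by omega
    simp only at h ⊢
    refine ⟨by simpa [Nat.mod_eq_of_lt hlt] using h, ?_, trivial⟩
    ext <;> simp [Nat.mod_eq_of_lt hlt]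
  · rintro ⟨t, j⟩ h
    simp only [not_not] at h ⊢
    rw [Nat.sub_eq_zero_iff_le]
    by_contra! hlt
    have : ((j : ℕ) + 1) % (z t + 1) = (j : ℕ) % (z t + 1) + 1 := by
      rw [← Nat.mod_add_mod, Nat.mod_eq_of_lt (by omega)]
    omega

/-- The assignment built from the table of a run. -/
def assignment (T D : ℕ) [NeZero D] (z : ℕ → ℕ → ℕ) (n i : ℕ) :
    Module.End ℚ (Fin (T + 1) × Fin D → ℚ) :=
  if i < 7 then diagOp fun a => z a.1 i
  else if i < 14 then lowerOp T D fun t => z t (i - 7)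
  else if i < 21 then raiseOp T D fun t => z t (i - 14)
  else if i < 28 then countOp T D fun t => z t (i - 21)
  else if i = 28 then shiftOp T D
  else if i = 29 then shiftBackOp T D
  else if i = 30 then diagOp fun a => a.1
  else n

theorem eq_zero_of_mul_proj {ι : Type*} [DecidableEq ι] {A : Module.End ℚ (ι → ℚ)} [Fintype ι]
    (h : ∀ i, A * diagOp (Pi.single i 1) = 0) : A = 0 := by
  refine LinearMap.pi_ext fun i c => ?_
  have hs : diagOp (Pi.single i 1) (Pi.single i c) = Pi.single i c := by
    ext j
    by_cases hj : j = i
    · subst hj; simp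
    · simp [hj]
  have := LinearMap.congr_fun (h i) (Pi.single i c)
  rwa [Module.End.mul_apply, hs] at this

theorem diagOp_mul_single {ι : Type*} [DecidableEq ι] (f : ι → ℕ) (i : ι) :
    diagOp f * diagOp (Pi.single i 1) = f i * diagOp (Pi.single i 1) := by
  rw [← nsmul_eq_mul]
  refine LinearMap.ext fun φ => funext fun j => ?_
  by_cases hj : j = i
  · subst hj; simp
  · simp [hj]

theorem isModel [NeZero D] (hz : IsRun rules (start.eval fun _ => n) T z)
    (hr : ∀ r ∈ rules, r.1.VarsBelow 5 ∧ r.2.VarsBelow 5) (hs : start.VarsBelow 1)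
    (hD : ∀ t ≤ T, ∀ i < 7, z t i + 1 ∣ D) : IsModel rules start n (assignment T D z n) := by
  have hdiag : ∀ i < 7, assignment T D z n i = diagOp fun a => z a.1 i := fun i hi => if_pos hi
  have h28 : assignment T D z n 28 = shiftOp T D := rfl
  have h29 : assignment T D z n 29 = shiftBackOp T D := rfl
  have h30 : assignment T D z n 30 = diagOp fun a => (a.1 : ℕ) := rfl
  have h31 : assignment T D z n 31 = n := rfl
  have h5 := hdiag 5 (by norm_num)
  have h6 := hdiag 6 (by norm_num)
  have hpast : ∀ a : Fin (T + 1) × Fin D, (a.1 : ℕ) ≠ 0 → (a.1 : ℕ) - 1 ≠ T ∧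
      ((Fin.ofNat (T + 1) (a.1 - 1 + 1), a.2) : Fin (T + 1) × Fin D) = a := by
    rintro ⟨⟨t, ht⟩, j⟩ h
    simp only at h
    refine ⟨by simp only; omega, ?_⟩
    ext
    · simp [Nat.sub_add_cancel (Nat.one_le_iff_ne_zero.2 h), Nat.mod_eq_of_lt ht]
    · rfl
  refine ⟨?_, ?_, ?_, ?_, ?_, ?_, ?_, ?_, ?_, h31⟩
  · intro i hi j hj
    rw [hdiag i hi, hdiag j hj, diagOp_comm]
  · intro i hi
    have := isLadder (z := fun t => z t i) (T := T) (D := D) fun t ht => hD t ht i hi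
    convert this using 1
    · exact hdiag i hi
    all_goals
      simp only [assignment]
      split_ifs <;> first | omega | simp
  · intro i hi
    rw [hdiag i hi, h30, diagOp_comm]
  · rw [h28, h30]
    refine LinearMap.ext fun φ => funext fun a => ?_
    by_cases ha : (a.1 : ℕ) = 0
    · simp [shiftOp, Fin.val_eq_zero_iff.1 ha]
    · have : ((a.1 : ℕ) : ℚ) = ((a.1 : ℕ) - 1 : ℕ) + 1 := by
        rw [← Nat.cast_succ, Nat.succ_eq_add_one, Nat.sub_add_cancel (by omega)]
      simp only [shiftOp, Module.End.mul_apply, diagOp_apply, pullOp_apply, LinearMap.add_apply,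
        Pi.add_apply, if_pos ha]
      rw [this]
      ring
  · rw [h28, h29, h30]
    exact diagOp_mul_one_sub _ _ _ _ _ hpast (by simp)
  · rw [h5, h6, h28]
    refine diagOp_mul_pullOp _ _ _ _ fun a ha => ?_
    simp only
    rw [hz.link _ (by omega), Nat.sub_add_cancel (by omega)]
  · have hstart := Pat.eval_term_mul (v := assignment T D z n) (f := fun _ => .var 31)
      (g := fun _ => n) (w := 1) (fun _ _ => by rw [RingTerm.eval, h31]) hs
    rw [mul_one, mul_one] at hstart
    rw [hstart, h5, h28, h29, ← nsmul_one]
    refine LinearMap.ext fun φ => funext fun a => ?_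
    by_cases ha : (a.1 : ℕ) = 0
    · simp [shiftOp, Fin.val_eq_zero_iff.1 ha, hz.start]
    · have : (1 - shiftOp T D * shiftBackOp T D) φ a = 0 := by
        simp only [shiftOp, shiftBackOp, LinearMap.sub_apply, Module.End.mul_apply,
          Module.End.one_apply, Pi.sub_apply, pullOp_apply, if_pos ha, if_pos (hpast a ha).1,
          (hpast a ha).2, sub_self]
      rw [Module.End.mul_apply, LinearMap.sub_apply, Pi.sub_apply, diagOp_apply,
        LinearMap.smul_apply, Pi.smul_apply, Module.End.one_apply, this]
      simp
  · rw [h5, h28, h29]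
    refine diagOp_mul_one_sub _ _ _ _ _ ?_ ?_
    · rintro ⟨⟨t, ht⟩, j⟩ h
      simp only at h
      have ht' : t + 1 < T + 1 := by omega
      refine ⟨by simp [Nat.mod_eq_of_lt ht'], ?_⟩
      ext <;> simp [Nat.mod_eq_of_lt ht']
    · intro a ha
      rw [not_not.1 ha, hz.halt]
  · refine eq_zero_of_mul_proj fun a => ?_
    refine eval_stepTerm_mul_eq_zero (g := z a.1) (fun i hi => ?_) ?_ (hz.step _)
    · rw [hdiag i hi, diagOp_mul_single]
    · exact List.forall_mem_cons.2 ⟨⟨trivial, trivial⟩, hr⟩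

end IsRun

/-! ### Undecidability -/

/-- The system has a common zero in rational matrices exactly when the rewriting system reaches `0`
from the starting configuration. -/
theorem exists_matrix_zero_iff {rules : List (Pat × Pat)} {start : Pat} {n : ℕ}
    (hr : ∀ r ∈ rules, r.1.VarsBelow 5 ∧ r.2.VarsBelow 5) (hs : start.VarsBelow 1) :
    (∃ d : ℕ, 1 ≤ d ∧ ∃ v : ℕ → Matrix (Fin d) (Fin d) ℚ,
      ∀ p ∈ inputTerm n :: systemTerms rules start, p.eval v = 0) ↔
    Relation.ReflTransGen (RewriteStep rules) (start.eval fun _ => n) 0 := by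
  constructor
  · rintro ⟨d, hd, v, hv⟩
    have : Nonempty (Fin d) := ⟨⟨0, hd⟩⟩
    exact (isModel_iff.1 hv).rewrites_to_zero hr hs
  · intro h
    obtain ⟨T, z, hz⟩ := exists_isRun hr h
    let D := ∏ t ∈ Finset.range (T + 1), ∏ i ∈ Finset.range 7, (z t i + 1)
    have : NeZero D := ⟨Finset.prod_ne_zero_iff.2 fun t _ =>
      Finset.prod_ne_zero_iff.2 fun i _ => Nat.succ_ne_zero _⟩
    have hD : ∀ t ≤ T, ∀ i < 7, z t i + 1 ∣ D := fun t ht i hi =>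
      (Finset.dvd_prod_of_mem (fun i => z t i + 1) (Finset.mem_range.2 hi)).trans
        (Finset.dvd_prod_of_mem (fun t => ∏ i ∈ Finset.range 7, (z t i + 1))
          (Finset.mem_range.2 (Nat.lt_succ_of_le ht)))
    let ι := Fin (T + 1) × Fin D
    let φ : Module.End ℚ (ι → ℚ) ≃ₐ[ℚ] Matrix (Fin (Fintype.card ι)) (Fin (Fintype.card ι)) ℚ :=
      LinearMap.toMatrixAlgEquiv'.trans (Matrix.reindexAlgEquiv ℚ ℚ (Fintype.equivFin ι))
    refine ⟨Fintype.card ι, Fintype.card_pos, fun i => φ (IsRun.assignment T D z n i),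
      fun p hp => ?_⟩
    have := RingTerm.map_eval (RingHomClass.toRingHom φ) (IsRun.assignment T D z n) p
    rw [isModel_iff.2 (hz.isModel hr hs hD) p hp, map_zero] at this
    exact this.symm

theorem primrec_code_numeral : Primrec fun n => (RingTerm.numeral n).code := by
  have hstep : Primrec fun m : ℕ => 6 * Nat.pair m 2 + 3 :=
    Primrec.nat_add.comp (Primrec.nat_mul.comp (Primrec.const 6)
      (Primrec₂.natPair.comp Primrec.id (Primrec.const 2))) (Primrec.const 3)
  refine (Primrec.nat_rec₁ 1 (hstep.comp Primrec.snd).to₂).of_eq fun n => ?_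
  induction n with
  | zero => rfl
  | succ n ih => simp only [ih, RingTerm.numeral, RingTerm.code]

theorem primrec_ringFamilyCode_inputTerm (ps : List RingTerm) :
    Primrec fun n => ringFamilyCode (inputTerm n :: ps) := by
  have hinput : Primrec fun n => (inputTerm n).code :=
    Primrec.nat_add.comp (Primrec.nat_mul.comp (Primrec.const 6)
      (Primrec₂.natPair.comp (Primrec.const (6 * 31)) (Primrec.nat_add.comp
        (Primrec.nat_mul.comp (Primrec.const 6) primrec_code_numeral) (Primrec.const 5))))
      (Primrec.const 3)
  exact Primrec.encode.comp
    (Primrec.list_cons.comp hinput (Primrec.const (ps.map RingTerm.code)))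

theorem exists_toPartrec_code_halting : ∃ c : Turing.ToPartrec.Code, ∀ e : Nat.Partrec.Code,
    (c.eval [Encodable.encode e]).Dom ↔ (e.eval 0).Dom := by
  have h : Partrec fun m : ℕ => (Denumerable.ofNat Nat.Partrec.Code m).eval 0 :=
    Nat.Partrec.Code.eval_part.comp (Computable.ofNat _) (Computable.const 0)
  obtain ⟨c, hc⟩ := Turing.ToPartrec.Code.exists_code (Nat.Partrec'.part_iff₁.2 h)
  refine ⟨c, fun e => ?_⟩
  have := hc ⟨[Encodable.encode e], rfl⟩
  rw [this]
  simp [List.Vector.head]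

/-- There is no algorithm deciding, for a given finite family
of multivariate polynomials in non-commuting variables with integer
coefficients, whether they have a common zero among the matrices in `ℚ^{d×d}`
for some finite `d ≥ 1`. -/
theorem rational_matrix_common_zero_undecidable :
    ¬ ∃ f : ℕ → Bool, Computable f ∧
      ∀ ps : List RingTerm, (f (ringFamilyCode ps) = true ↔
        ∃ d : ℕ, 1 ≤ d ∧ ∃ v : ℕ → Matrix (Fin d) (Fin d) ℚ,
          ∀ p ∈ ps, p.eval v = 0) := by
  rintro ⟨f, hf, hdec⟩
  obtain ⟨c, hc⟩ := exists_toPartrec_code_halting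
  let start : Pat := PatMachine.normalPat (.num (PatMachine.encodeCode c))
    (.num (PatMachine.encodeCont .halt)) (.pair (.var 0) (.num 0))
  have hs : start.VarsBelow 1 := by simp [start, PatMachine.normalPat, Pat.VarsBelow]
  refine ComputablePred.halting_problem 0 (ComputablePred.computable_iff.2
    ⟨fun e => f (ringFamilyCode
      (inputTerm (Encodable.encode e) :: systemTerms PatMachine.rules start)),
      hf.comp ((primrec_ringFamilyCode_inputTerm _).comp Primrec.encode).to_comp, ?_⟩)
  funext e
  rw [hdec, exists_matrix_zero_iff PatMachine.rules_varsBelow hs, ← hc,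
    ← PatMachine.rewrites_to_zero_iff]
  rfl
end
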